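/- arXiv:math/0411650 — 5 statements merged into one kernel-verified Lean document; each statement's English description precedes it below -/
import Mathlib

section
/- (General multivariate Faà di Bruno formula.) For every integer κ ≥ 1 and every choice of indices i_1,…,i_κ ∈ {1,…,n}: ∂^κ h / (∂x^{i_1} ⋯ ∂x^{i_κ}) (x) = Σ_{d=1}^{κ} Σ_{1≤λ_1<⋯<λ_d≤κ} Σ_{μ_1≥1,…,μ_d≥1 with μ_1λ_1+⋯+μ_dλ_d = κ} Σ_{l_{1:1},…,l_{1:μ_1},…,l_{d:1},…,l_{d:μ_d} = 1}^{m} ∂^{μ_1+⋯+μ_d} f / (∂y^{l_{1:1}} ⋯ ∂y^{l_{1:μ_1}} ⋯ ∂y^{l_{d:1}} ⋯ ∂y^{l_{d:μ_d}}) evaluated at (g^1(x),…,g^m(x)), times [ Σ_{σ ∈ F^{(μ,λ)}_κ} Π_{e=1}^{d} Π_{ν=1}^{μ_e} ∂^{λ_e} g^{l_{e:ν}} / (∂x^{i_{σ(e:ν:1)}} ⋯ ∂x^{i_{σ(e:ν:λ_e)}}) (x) ], where {1,…,κ} is identified with the set of triples (e:ν:γ) as described, and the inner sum is independent of the choice of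 coset representatives F^{(μ,λ)}_κ. -/
/-- Iterated partial derivative of `F : ℝⁿ → ℝ` with respect to the coordinates listed
in `xs`. -/
noncomputable def pdl {n : ℕ} : List (Fin n) → ((Fin n → ℝ) → ℝ) → ((Fin n → ℝ) → ℝ)
  | [], F => F
  | a :: l, F => fun x => deriv (fun t => pdl l F (Function.update x a t)) (x a)

/-- Iterated partial derivative of `f : ℝᵐ → ℝ` with respect to the coordinates listed
in `ys`. -/
noncomputable def pdfl {m : ℕ} : List (Fin m) → ((Fin m → ℝ) → ℝ) → ((Fin m → ℝ) → ℝ)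
  | [], F => F
  | a :: ls, F => fun y => deriv (fun t => pdfl ls F (Function.update y a t)) (y a)

/-- The index set of triples `(e:ν:γ)` attached to block data: for `e : Fin d` there are
`mu' e + 1` blocks (indexed by `ν`), each of size `lam' e + 1` (positions indexed by `γ`).
(The data `lam', mu'` are the numbers `λ_e - 1`, `μ_e - 1`, so that `λ_e, μ_e ≥ 1`
automatically.) -/
abbrev Triple (d : ℕ) (lam' mu' : Fin d → ℕ) : Type :=
  (e : Fin d) × (Fin (mu' e + 1) × Fin (lam' e + 1))

/-- Lexicographic position (0-indexed) of a triple inside `{0,…,N-1}`,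
`N = Σ_e μ_e λ_e`. -/
def encT {d : ℕ} (lam' mu' : Fin d → ℕ) (t : Triple d lam' mu') : ℕ :=
  (∑ e' ∈ Finset.univ.filter (fun e' : Fin d => e' < t.1), (mu' e' + 1) * (lam' e' + 1))
    + (t.2.1 : ℕ) * (lam' t.1 + 1) + (t.2.2 : ℕ)

/-- Membership in the subgroup `H`: a permutation of the triples belongs to `H` iff it
maps each block `(e,ν)` setwise onto some block `(e,ν')` with the same family index. -/
def inH {d : ℕ} (lam' mu' : Fin d → ℕ) (σ : Equiv.Perm (Triple d lam' mu')) : Prop :=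
  ∀ (e : Fin d) (ν : Fin (mu' e + 1)) (γ γ' : Fin (lam' e + 1)),
    (σ ⟨e, (ν, γ)⟩).1 = e ∧ ((σ ⟨e, (ν, γ)⟩).2.1 : ℕ) = ((σ ⟨e, (ν, γ')⟩).2.1 : ℕ)

/-- The list of the dependent-variable indices `l_{1:1},…,l_{1:μ_1},…,l_{d:1},…,l_{d:μ_d}`
in lexicographic order. -/
def blkList {m d : ℕ} {mu' : Fin d → ℕ} (l : ((e : Fin d) × Fin (mu' e + 1)) → Fin m) :
    List (Fin m) :=
  ((List.finRange d).map (fun e => List.ofFn (fun ν : Fin (mu' e + 1) => l ⟨e, ν⟩))).flatten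

section FdBHelpers

open Finset

lemma pdfl_eq_pdl {m : ℕ} (L : List (Fin m)) (F : (Fin m → ℝ) → ℝ) : pdfl L F = pdl L F := by
  induction L with
  | nil => rfl
  | cons a L ih => simp only [pdfl, pdl, ih]

lemma deriv_update_eq {n : ℕ} {F : (Fin n → ℝ) → ℝ} (x : Fin n → ℝ)
    (hF : DifferentiableAt ℝ F x) (a : Fin n) :
    deriv (fun t => F (Function.update x a t)) (x a) = fderiv ℝ F x (Pi.single a 1) := by
  have h1 := hasDerivAt_update x a (x a)
  have h2 : HasFDerivAt F (fderiv ℝ F x) (Function.update x a (x a)) := by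
    simpa using hF.hasFDerivAt
  exact (h2.comp_hasDerivAt (x a) h1).deriv

lemma pdl_contDiff {n : ℕ} (L : List (Fin n)) {F : (Fin n → ℝ) → ℝ}
    (hF : ContDiff ℝ (⊤ : ℕ∞) F) : ContDiff ℝ (⊤ : ℕ∞) (pdl L F) := by
  induction L with
  | nil => exact hF
  | cons a L ih =>
    have : pdl (a :: L) F = fun x => fderiv ℝ (pdl L F) x (Pi.single a 1) := by
      funext x
      exact deriv_update_eq x (ih.differentiable (by simp) x) a
    rw [this]
    exact (ih.fderiv_right (m := ((⊤ : ℕ∞) : WithTop ℕ∞)) (by simp)).clm_apply contDiff_const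

lemma pdl_cons {n : ℕ} (a : Fin n) (L : List (Fin n)) {F : (Fin n → ℝ) → ℝ}
    (hF : ContDiff ℝ (⊤ : ℕ∞) F) (x : Fin n → ℝ) :
    pdl (a :: L) F x = fderiv ℝ (pdl L F) x (Pi.single a 1) :=
  deriv_update_eq x ((pdl_contDiff L hF).differentiable (by simp) x) a

lemma pdl_ofFn {n : ℕ} {F : (Fin n → ℝ) → ℝ} (hF : ContDiff ℝ (⊤ : ℕ∞) F) (k : ℕ)
    (v : Fin k → Fin n) (x : Fin n → ℝ) :
    pdl (List.ofFn v) F x = iteratedFDeriv ℝ k F x (fun j => Pi.single (v j) 1) := by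
  induction k generalizing x with
  | zero => simp [pdl]
  | succ k ih =>
    rw [List.ofFn_succ, pdl_cons _ _ hF, iteratedFDeriv_succ_apply_left]
    have h1 : pdl (List.ofFn fun j : Fin k => v j.succ) F =
      fun x => iteratedFDeriv ℝ k F x (fun j => Pi.single (v j.succ) 1) := by
      funext y; exact ih _ y
    rw [h1]
    have hd : DifferentiableAt ℝ (iteratedFDeriv ℝ k F) x :=
      (hF.differentiable_iteratedFDeriv (m := k) (by exact_mod_cast ENat.natCast_lt_top k)) x
    rw [fderiv_continuousMultilinear_apply_const_apply hd]
    rfl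

lemma pdl_perm {n : ℕ} {F : (Fin n → ℝ) → ℝ} (hF : ContDiff ℝ (⊤ : ℕ∞) F)
    {L L' : List (Fin n)} (h : L.Perm L') : pdl L F = pdl L' F := by
  induction h with
  | nil => rfl
  | cons a h ih => simp only [pdl, ih]
  | trans _ _ h1 h2 => exact h1.trans h2
  | swap a b L =>
    funext x
    have hs := pdl_contDiff L hF
    have hfd : DifferentiableAt ℝ (fderiv ℝ (pdl L F)) x :=
      (hs.fderiv_right (m := ((⊤ : ℕ∞) : WithTop ℕ∞)) (by simp)).differentiable (by simp) x
    have key : ∀ a b : Fin n, pdl (a :: b :: L) F x =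
        fderiv ℝ (fderiv ℝ (pdl L F)) x (Pi.single a 1) (Pi.single b 1) := by
      intro a b
      rw [pdl_cons _ _ hF]
      have : pdl (b :: L) F = fun x => fderiv ℝ (pdl L F) x (Pi.single b 1) := by
        funext y; exact pdl_cons _ _ hF y
      rw [this, fderiv_clm_apply hfd (by fun_prop)]
      simp
    rw [key, key]
    have := (hs.contDiffAt (x := x)).isSymmSndFDerivAt
      (by simp only [minSmoothness_of_isRCLikeNormedField]; exact WithTop.coe_le_coe.2 (le_top : (2 : ℕ∞) ≤ ⊤))
    exact this _ _

/-- Iterated partial derivative along a multiset of coordinates. -/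
noncomputable def pdm {n : ℕ} (s : Multiset (Fin n)) (F : (Fin n → ℝ) → ℝ) :
    (Fin n → ℝ) → ℝ := pdl s.toList F

lemma pdl_eq_pdm {n : ℕ} {F : (Fin n → ℝ) → ℝ} (hF : ContDiff ℝ (⊤ : ℕ∞) F)
    (L : List (Fin n)) (s : Multiset (Fin n)) (h : (L : Multiset (Fin n)) = s) :
    pdl L F = pdm s F := by
  subst h
  apply pdl_perm hF
  rw [← Multiset.coe_eq_coe, Multiset.coe_toList]

/-- The Faà di Bruno term attached to a labelled partition `p : Fin κ → B`. -/
noncomputable def fdbTerm {n m κ : ℕ} (g : Fin m → (Fin n → ℝ) → ℝ) (f : (Fin m → ℝ) → ℝ)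
    (i : Fin κ → Fin n) (x : Fin n → ℝ) (B : Type) [Fintype B] (p : Fin κ → B) : ℝ :=
  by classical exact
  ∑ l : B → Fin m, pdm (univ.val.map l) f (fun l' => g l' x) *
    ∏ b : B, pdm ((univ.filter (fun a => p a = b)).val.map i) (g (l b)) x

lemma fdbTerm_equiv {n m κ : ℕ} (g : Fin m → (Fin n → ℝ) → ℝ) (f : (Fin m → ℝ) → ℝ)
    (i : Fin κ → Fin n) (x : Fin n → ℝ) (B B' : Type) [Fintype B] [Fintype B']
    (p : Fin κ → B) (p' : Fin κ → B') (e : B ≃ B') (h : ∀ a, p' a = e (p a)) :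
    fdbTerm g f i x B p = fdbTerm g f i x B' p' := by
  classical
  unfold fdbTerm
  refine Fintype.sum_equiv (e.arrowCongr (Equiv.refl _)) _ _ fun l => ?_
  congr 1
  · congr 1
    have h1 : (univ : Finset B').val = (univ : Finset B).val.map e := by
      rw [← Finset.map_univ_equiv e]; rfl
    rw [h1, Multiset.map_map]
    congr 1
    funext b; simp
  · refine Fintype.prod_equiv e _ _ fun b => ?_
    simp [h]

lemma fdbTerm_ker {n m κ : ℕ} (g : Fin m → (Fin n → ℝ) → ℝ) (f : (Fin m → ℝ) → ℝ)
    (i : Fin κ → Fin n) (x : Fin n → ℝ) (B B' : Type) [Fintype B] [Fintype B']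
    (p : Fin κ → B) (p' : Fin κ → B') (hp : p.Surjective) (hp' : p'.Surjective)
    (h : Setoid.ker p = Setoid.ker p') :
    fdbTerm g f i x B p = fdbTerm g f i x B' p' := by
  have hh : ∀ a b, p a = p b ↔ p' a = p' b := by
    intro a b
    rw [← Setoid.ker_def, ← Setoid.ker_def, h]
  choose q hq using hp
  choose q' hq' using hp'
  refine fdbTerm_equiv g f i x B B' p p' ⟨fun b => p' (q b), fun b => p (q' b), ?_, ?_⟩ ?_
  · intro b
    have := (hh (q' (p' (q b))) (q b)).2 (hq' _)
    simp only [this, hq]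
  · intro b
    have := (hh (q (p (q' b))) (q' b)).1 (hq _)
    simp only [this, hq']
  · intro a
    exact ((hh (q (p a)) a).1 (hq _)).symm

lemma ofp_index_emb {κ : ℕ} (c : OrderedFinpartition κ) (j : Fin c.length)
    (r : Fin (c.partSize j)) : c.index (c.emb j r) = j :=
  congrArg Sigma.fst (c.equivSigma.symm_apply_apply ⟨j, r⟩)

lemma ofp_filter {κ : ℕ} (c : OrderedFinpartition κ) (j : Fin c.length) :
    univ.filter (fun a => c.index a = j) = univ.map ⟨c.emb j, (c.emb_strictMono j).injective⟩ := by
  ext a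
  simp only [mem_filter, mem_univ, true_and, mem_map, Function.Embedding.coeFn_mk]
  constructor
  · rintro rfl
    exact ⟨c.invEmbedding a, c.emb_invEmbedding a⟩
  · rintro ⟨r, rfl⟩
    exact ofp_index_emb c j r

lemma ofFn_coe {α : Type*} {k : ℕ} (v : Fin k → α) :
    ((List.ofFn v : List α) : Multiset α) = univ.val.map v := by
  simp [List.ofFn_eq_map]

lemma lhs_eq {n m κ : ℕ} (g : Fin m → (Fin n → ℝ) → ℝ) (f : (Fin m → ℝ) → ℝ)
    (hg : ∀ l, ContDiff ℝ (⊤ : ℕ∞) (g l)) (hf : ContDiff ℝ (⊤ : ℕ∞) f)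
    (i : Fin κ → Fin n) (x : Fin n → ℝ) :
    pdl (List.ofFn i) (fun z => f (fun l => g l z)) x =
      ∑ c : OrderedFinpartition κ, fdbTerm g f i x (Fin c.length) c.index := by
  classical
  have hG : ContDiff ℝ (⊤ : ℕ∞) (fun z => fun l => g l z) := contDiff_pi.2 hg
  change pdl (List.ofFn i) (f ∘ fun z => fun l => g l z) x = _
  rw [pdl_ofFn (hf.comp hG)]
  have := iteratedFDeriv_comp (𝕜 := ℝ) (g := f) (f := fun z => fun l => g l z) (x := x)
    (n := ((⊤ : ℕ∞) : WithTop ℕ∞))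
    hf.contDiffAt hG.contDiffAt (i := κ) (by exact_mod_cast le_top)
  rw [this]
  simp only [FormalMultilinearSeries.taylorComp, _root_.sum_apply]
  refine Finset.sum_congr rfl fun c _ => ?_
  rw [FormalMultilinearSeries.compAlongOrderedFinpartition_apply]
  set w : Fin c.length → Fin m → ℝ := fun j l => pdl (List.ofFn (i ∘ c.emb j)) (g l) x with hw
  have h1 : (c.applyOrderedFinpartition
      (fun j ↦ (ftaylorSeries ℝ (fun z => fun l => g l z) x (c.partSize j))) fun a => Pi.single (i a) 1)
      = fun j => ∑ l, w j l • (Pi.single l 1 : Fin m → ℝ) := by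
    funext j
    rw [OrderedFinpartition.applyOrderedFinpartition_apply]
    funext l
    have h2 := (ContinuousLinearMap.proj (R := ℝ) (φ := fun _ : Fin m => ℝ) l).iteratedFDeriv_comp_left
      (f := fun z => fun l => g l z) (x := x) (n := ((⊤ : ℕ∞) : WithTop ℕ∞)) hG.contDiffAt
      (i := c.partSize j) (by exact_mod_cast le_top)
    have h3 := congrArg (fun M => M ((fun a => Pi.single (i a) (1:ℝ)) ∘ c.emb j)) h2
    simp only [ContinuousLinearMap.compContinuousMultilinearMap_coe, Function.comp_apply,
      ContinuousLinearMap.proj_apply] at h3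
    simp only [ftaylorSeries]
    rw [← h3]
    simp only [Finset.sum_apply, Pi.smul_apply, Pi.single_apply, smul_eq_mul, mul_ite, mul_one,
      mul_zero, Finset.sum_ite_eq, Finset.mem_univ, if_true, hw]
    rw [pdl_ofFn (hg l)]
    rfl
  rw [h1, ContinuousMultilinearMap.map_sum]
  unfold fdbTerm
  refine Finset.sum_congr (by ext; simp) fun l _ => ?_
  rw [ContinuousMultilinearMap.map_smul_univ, smul_eq_mul, mul_comm]
  congr 1
  · rw [← pdl_eq_pdm hf _ _ (ofFn_coe l), pdl_ofFn hf]
    rfl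
  · refine Finset.prod_congr rfl fun j _ => ?_
    rw [hw]
    dsimp only
    rw [pdl_eq_pdm (hg _) _ _ (ofFn_coe _)]
    congr 1
    trans Multiset.map i ((univ.filter (fun a => c.index a = j)).val)
    · rw [ofp_filter, Finset.map_val, Multiset.map_map]
      rfl
    · congr!

/-- The setoid of an ordered finpartition. -/
noncomputable def ofpSetoid {κ : ℕ} (c : OrderedFinpartition κ) : Setoid (Fin κ) :=
  Setoid.ker c.index

lemma ofp_index_surj {κ : ℕ} (c : OrderedFinpartition κ) : Function.Surjective c.index :=
  fun j => ⟨c.emb j ⟨0, c.partSize_pos j⟩, ofp_index_emb c j _⟩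

lemma ofp_range_emb {κ : ℕ} (c : OrderedFinpartition κ) (j : Fin c.length) :
    Set.range (c.emb j) = {a | c.index a = j} := by
  ext a
  constructor
  · rintro ⟨r, rfl⟩
    exact ofp_index_emb c j r
  · rintro rfl
    exact ⟨c.invEmbedding a, c.emb_invEmbedding a⟩

lemma strictMono_fin_unique {k k' : ℕ} {α : Type*} [LinearOrder α] (u : Fin k → α) (v : Fin k' → α)
    (hu : StrictMono u) (hv : StrictMono v) (h : Set.range u = Set.range v) :
    ∃ hk : k = k', ∀ a, u a = v (Fin.cast hk a) := by
  have hk : k = k' := by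
    have h1 := Set.ncard_range_of_injective hu.injective
    have h2 := Set.ncard_range_of_injective hv.injective
    rw [h, h2] at h1
    simpa using h1.symm
  subst hk
  refine ⟨rfl, fun a => ?_⟩
  have := (StrictMono.range_inj hu hv).1 h
  rw [this]; rfl

lemma ofp_last_range {κ : ℕ} (c : OrderedFinpartition κ) :
    Set.range (fun m ↦ c.emb m ⟨c.partSize m - 1, Nat.sub_one_lt_of_lt (c.partSize_pos m)⟩)
      = {a | ∀ b, c.index b = c.index a → b ≤ a} := by
  ext a
  constructor
  · rintro ⟨j, rfl⟩ b hb
    dsimp only at hb ⊢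
    rw [ofp_index_emb] at hb
    have : b ∈ Set.range (c.emb j) := by rw [ofp_range_emb]; exact hb
    obtain ⟨r, rfl⟩ := this
    apply (c.emb_strictMono j).monotone
    rw [Fin.le_def]
    have := r.2
    simp only
    omega
  · intro ha
    refine ⟨c.index a, ?_⟩
    apply le_antisymm
    · exact ha _ (ofp_index_emb c _ _)
    · conv_lhs => rw [← c.emb_invEmbedding a]
      apply (c.emb_strictMono _).monotone
      rw [Fin.le_def]
      have := (c.invEmbedding a).2
      simp only
      omega

lemma ofpSetoid_injective (κ : ℕ) : Function.Injective (ofpSetoid (κ := κ)) := by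
  intro c c' h
  have hh : ∀ a b, c.index a = c.index b ↔ c'.index a = c'.index b := by
    intro a b
    rw [← Setoid.ker_def, ← Setoid.ker_def]
    exact iff_of_eq (congrArg (fun s : Setoid (Fin κ) => s a b) h)
  have hr := (ofp_last_range c).trans (Eq.trans (by simp only [hh]) (ofp_last_range c').symm)
  obtain ⟨hk, hl⟩ := strictMono_fin_unique _ _ c.parts_strictMono c'.parts_strictMono hr
  have hr2 : ∀ j, Set.range (c.emb j) = Set.range (c'.emb (Fin.cast hk j)) := by
    intro j
    rw [ofp_range_emb, ofp_range_emb]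
    have h1 := hl j
    ext a
    simp only [Set.mem_ofPred_eq]
    have h2 := ofp_index_emb c j ⟨c.partSize j - 1, Nat.sub_one_lt_of_lt (c.partSize_pos j)⟩
    have h3 := ofp_index_emb c' (Fin.cast hk j)
      ⟨c'.partSize (Fin.cast hk j) - 1, Nat.sub_one_lt_of_lt (c'.partSize_pos _)⟩
    conv_lhs => rw [← h2]
    conv_rhs => rw [← h3]
    rw [hh, h1]
  have hr3 := fun j => strictMono_fin_unique _ _ (c.emb_strictMono j) (c'.emb_strictMono _) (hr2 j)
  clear hr2 hl hr hh h
  rcases c with ⟨len, ps, _, emb, _, _, _, _⟩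
  rcases c' with ⟨len', ps', _, emb', _, _, _, _⟩
  dsimp only at hk hr3
  subst hk
  have hps : ps = ps' := funext fun j => (hr3 j).1
  subst hps
  have : emb = emb' := by
    funext j r
    exact (hr3 j).2 r
  subst this
  rfl

lemma ofpSetoid_surjective (κ : ℕ) : Function.Surjective (ofpSetoid (κ := κ)) := by
  classical
  intro s
  -- class of an element
  let cl : Fin κ → Finset (Fin κ) := fun a => univ.filter (fun b => s b a)
  have hcl : ∀ a b, b ∈ cl a ↔ s b a := by intro a b; simp [cl]
  have hclne : ∀ a, (cl a).Nonempty := fun a => ⟨a, (hcl a a).2 (s.refl' a)⟩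
  let M : Finset (Fin κ) := univ.filter (fun a => ∀ b, s b a → b ≤ a)
  have hM : ∀ a, a ∈ M ↔ ∀ b, s b a → b ≤ a := by intro a; simp [M]
  let top : Fin M.card → Fin κ := M.orderEmbOfFin rfl
  have htopM : ∀ j, ∀ b, s b (top j) → b ≤ top j := fun j => (hM _).1 (M.orderEmbOfFin_mem rfl j)
  have htop : ∀ a ∈ M, ∃ j, top j = a := by
    intro a ha
    have := M.range_orderEmbOfFin rfl
    have h2 : a ∈ Set.range (M.orderEmbOfFin rfl) := by rw [this]; exact ha
    exact h2
  have hlast : ∀ j, (cl (top j)).orderEmbOfFin rfl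
      ⟨(cl (top j)).card - 1, Nat.sub_one_lt_of_lt (Finset.card_pos.2 (hclne _))⟩ = top j := by
    intro j
    rw [Finset.orderEmbOfFin_last rfl (Finset.card_pos.2 (hclne _))]
    apply le_antisymm
    · apply Finset.max'_le
      intro b hb
      exact htopM j b ((hcl _ _).1 hb)
    · apply Finset.le_max'
      exact (hcl _ _).2 (s.refl' _)
  have hdisj : ∀ j j', s (top j) (top j') → j = j' := by
    intro j j' h
    have h1 := htopM j' _ h
    have h2 := htopM j _ (s.symm' h)
    exact (M.orderEmbOfFin rfl).injective (le_antisymm h1 h2)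
  let c : OrderedFinpartition κ :=
    { length := M.card
      partSize := fun j => (cl (top j)).card
      partSize_pos := fun j => Finset.card_pos.2 (hclne _)
      emb := fun j => (cl (top j)).orderEmbOfFin rfl
      emb_strictMono := fun j => OrderEmbedding.strictMono _
      parts_strictMono := by
        intro j j' h
        dsimp only
        rw [hlast, hlast]
        exact (M.orderEmbOfFin rfl).strictMono h
      disjoint := by
        intro j _ j' _ hjj
        rw [Function.onFun, Set.disjoint_left]
        intro a ha ha'
        rw [Finset.range_orderEmbOfFin, Finset.mem_coe, hcl] at ha ha'
        exact hjj (hdisj _ _ (s.trans' (s.symm' ha) ha'))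
      cover := by
        intro a
        have h1 : (cl a).max' (hclne a) ∈ M := by
          rw [hM]
          intro b hb
          apply Finset.le_max'
          rw [hcl]
          exact s.trans' hb ((hcl _ _).1 (Finset.max'_mem _ _))
        obtain ⟨j, hj⟩ := htop _ h1
        refine ⟨j, ?_⟩
        rw [Finset.range_orderEmbOfFin, Finset.mem_coe, hcl, hj]
        exact s.symm' ((hcl _ _).1 (Finset.max'_mem _ _)) }
  refine ⟨c, ?_⟩
  have hc : ∀ a, s a (top (c.index a)) := by
    intro a
    have h1 := c.emb_invEmbedding a
    have h2 : c.emb (c.index a) (c.invEmbedding a) ∈ cl (top (c.index a)) :=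
      Finset.orderEmbOfFin_mem _ rfl _
    rw [h1, hcl] at h2
    exact h2
  ext a b
  change c.index a = c.index b ↔ s a b
  constructor
  · intro h
    have h1 := hc a
    rw [h] at h1
    exact s.trans' h1 (s.symm' (hc b))
  · intro h
    exact hdisj _ _ (s.trans' (s.symm' (hc a)) (s.trans' h (hc b)))

lemma lhs_eq_setoid {n m κ : ℕ} (g : Fin m → (Fin n → ℝ) → ℝ) (f : (Fin m → ℝ) → ℝ)
    (hg : ∀ l, ContDiff ℝ (⊤ : ℕ∞) (g l)) (hf : ContDiff ℝ (⊤ : ℕ∞) f)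
    (i : Fin κ → Fin n) (x : Fin n → ℝ) [Fintype (Setoid (Fin κ))]
    [∀ s : Setoid (Fin κ), Fintype (Quotient s)] :
    pdl (List.ofFn i) (fun z => f (fun l => g l z)) x =
      ∑ s : Setoid (Fin κ), fdbTerm g f i x (Quotient s) (Quotient.mk s) := by
  rw [lhs_eq g f hg hf]
  refine Fintype.sum_bijective ofpSetoid
    ⟨ofpSetoid_injective κ, ofpSetoid_surjective κ⟩ _ _ fun c => ?_
  apply fdbTerm_ker
  · exact ofp_index_surj c
  · exact Quotient.mk_surjective
  · exact (Setoid.ker_mk_eq (ofpSetoid c)).symm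

lemma exists_encEquiv {d κ : ℕ} (lam mu : Fin d → ℕ) (h : ∑ e, (mu e + 1) * (lam e + 1) = κ) :
    ∃ E : Triple d lam mu ≃ Fin κ, ∀ t, (E t : ℕ) = encT lam mu t := by
  let E1 : Triple d lam mu ≃ (e : Fin d) × Fin ((mu e + 1) * (lam e + 1)) :=
    Equiv.sigmaCongrRight fun e => finProdFinEquiv
  refine ⟨(E1.trans finSigmaFinEquiv).trans (finCongr h), ?_⟩
  rintro ⟨e, ν, γ⟩
  simp only [Equiv.trans_apply, finCongr_apply, Fin.val_cast, finSigmaFinEquiv_apply, encT]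
  have h2 : ((E1 ⟨e, ν, γ⟩).2 : ℕ) = γ + (lam e + 1) * ν := rfl
  rw [h2]
  have h3 : (∑ i : Fin (e : ℕ), (mu (Fin.castLE e.2.le i) + 1) * (lam (Fin.castLE e.2.le i) + 1))
      = ∑ e' ∈ univ.filter (fun e' : Fin d => e' < e), (mu e' + 1) * (lam e' + 1) := by
    refine Finset.sum_bij (fun i _ => Fin.castLE e.2.le i) ?_ ?_ ?_ ?_
    · intro a _
      rw [mem_filter]
      exact ⟨mem_univ _, a.2⟩
    · intro a _ b _ hab
      simpa using hab
    · intro b hb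
      have hb' : (b : ℕ) < e := (mem_filter.1 hb).2
      exact ⟨⟨b, hb'⟩, mem_univ _, rfl⟩
    · intro a _
      rfl
  have h4 : (∑ i : Fin ((E1 ⟨e, ν, γ⟩).1 : ℕ), (mu (Fin.castLE (E1 ⟨e, ν, γ⟩).1.2.le i) + 1)
      * (lam (Fin.castLE (E1 ⟨e, ν, γ⟩).1.2.le i) + 1))
      = ∑ e' ∈ univ.filter (fun e' : Fin d => e' < e), (mu e' + 1) * (lam e' + 1) := h3
  rw [h4]
  ring

/-- The lexicographic identification of the triples with `Fin κ`. -/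
noncomputable def encEquiv {d κ : ℕ} (lam mu : Fin d → ℕ)
    (h : ∑ e, (mu e + 1) * (lam e + 1) = κ) : Triple d lam mu ≃ Fin κ :=
  (exists_encEquiv lam mu h).choose

lemma encEquiv_apply {d κ : ℕ} (lam mu : Fin d → ℕ)
    (h : ∑ e, (mu e + 1) * (lam e + 1) = κ) (t : Triple d lam mu) :
    (encEquiv lam mu h t : ℕ) = encT lam mu t :=
  (exists_encEquiv lam mu h).choose_spec t

/-- The block of a triple. -/
def tblk {d : ℕ} {lam mu : Fin d → ℕ} (t : Triple d lam mu) :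
    (e : Fin d) × Fin (mu e + 1) := ⟨t.1, t.2.1⟩

/-- The block of an element, given a numbering of the triples. -/
def blkW {d κ : ℕ} {lam mu : Fin d → ℕ} (W : Triple d lam mu ≃ Fin κ) (a : Fin κ) :
    (e : Fin d) × Fin (mu e + 1) := tblk (W.symm a)

lemma blkW_apply {d κ : ℕ} {lam mu : Fin d → ℕ} (W : Triple d lam mu ≃ Fin κ)
    (e : Fin d) (ν : Fin (mu e + 1)) (γ : Fin (lam e + 1)) :
    blkW W (W ⟨e, ν, γ⟩) = ⟨e, ν⟩ := by
  rw [blkW, Equiv.symm_apply_apply]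
  rfl

lemma blkW_surj {d κ : ℕ} {lam mu : Fin d → ℕ} (W : Triple d lam mu ≃ Fin κ) :
    Function.Surjective (blkW W) := fun ⟨e, ν⟩ => ⟨W ⟨e, ν, 0⟩, blkW_apply W e ν 0⟩

lemma blkW_filter {d κ : ℕ} {lam mu : Fin d → ℕ} (W : Triple d lam mu ≃ Fin κ)
    (e : Fin d) (ν : Fin (mu e + 1)) :
    univ.filter (fun a => blkW W a = ⟨e, ν⟩) =
      univ.map ⟨fun γ : Fin (lam e + 1) => W ⟨e, ν, γ⟩, fun γ γ' h => by simpa using h⟩ := by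
  ext a
  simp only [mem_filter, mem_univ, true_and, mem_map]
  constructor
  · intro h
    obtain ⟨⟨e', ν', γ'⟩, rfl⟩ := W.surjective a
    rw [blkW_apply] at h
    cases h
    exact ⟨γ', rfl⟩
  · rintro ⟨r, rfl⟩
    exact blkW_apply W e ν r

lemma coe_flatten_map {α β : Type*} (L : List α) (F : α → List β) :
    (((L.map F).flatten : List β) : Multiset β) = (L.map (fun e => (F e : Multiset β))).sum := by
  induction L with
  | nil => simp
  | cons a L ih =>
    simp only [List.map_cons, List.flatten_cons, List.sum_cons, ← ih]
    rfl

lemma coe_blkList {m d : ℕ} {mu' : Fin d → ℕ} (l : ((e : Fin d) × Fin (mu' e + 1)) → Fin m) :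
    ((blkList l : List (Fin m)) : Multiset (Fin m)) = univ.val.map l := by
  have h1 : ∀ {α : Type} [Fintype α] (l : α → Fin m),
      (univ : Finset α).val.map l = ∑ b, ({l b} : Multiset (Fin m)) := by
    intro α _ l
    rw [← Finset.sum_map_val, ← Multiset.sum_map_singleton (Multiset.map l univ.val),
      Multiset.map_map]
    rfl
  rw [blkList, coe_flatten_map, ← Fin.sum_univ_def, h1, Fintype.sum_sigma]
  refine Finset.sum_congr rfl fun e _ => ?_
  rw [ofFn_coe, h1]

lemma ker_equiv {κ : ℕ} {B B' : Type}
    (p : Fin κ → B) (p' : Fin κ → B') (hp : p.Surjective) (hp' : p'.Surjective)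
    (h : Setoid.ker p = Setoid.ker p') : ∃ θ : B ≃ B', ∀ a, p' a = θ (p a) := by
  have hh : ∀ a b, p a = p b ↔ p' a = p' b := by
    intro a b
    rw [← Setoid.ker_def, ← Setoid.ker_def, h]
  choose q hq using hp
  choose q' hq' using hp'
  refine ⟨⟨fun b => p' (q b), fun b => p (q' b), ?_, ?_⟩, ?_⟩
  · intro b
    have := (hh (q' (p' (q b))) (q b)).2 (hq' _)
    simp only [this, hq]
  · intro b
    have := (hh (q (p (q' b))) (q' b)).1 (hq _)
    simp only [this, hq']
  · intro a
    exact ((hh (q (p a)) a).1 (hq _)).symm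

lemma blkW_card {d κ : ℕ} {lam mu : Fin d → ℕ} (W : Triple d lam mu ≃ Fin κ)
    (b : (e : Fin d) × Fin (mu e + 1)) :
    (univ.filter (fun a => blkW W a = b)).card = lam b.1 + 1 := by
  obtain ⟨e, ν⟩ := b
  rw [blkW_filter]
  simp

lemma theta_lam {d d' κ : ℕ} {lam mu : Fin d → ℕ} {lam' mu' : Fin d' → ℕ}
    (W : Triple d lam mu ≃ Fin κ) (W' : Triple d' lam' mu' ≃ Fin κ)
    (θ : ((e : Fin d) × Fin (mu e + 1)) ≃ ((e : Fin d') × Fin (mu' e + 1)))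
    (hθ : ∀ a, blkW W' a = θ (blkW W a)) (b : (e : Fin d) × Fin (mu e + 1)) :
    lam' (θ b).1 = lam b.1 := by
  have h1 := blkW_card W b
  have h2 := blkW_card W' (θ b)
  simp only [hθ, EmbeddingLike.apply_eq_iff_eq] at h2
  rw [h1] at h2
  omega

lemma shape_inj {d d' κ : ℕ} {lam mu : Fin d → ℕ} {lam' mu' : Fin d' → ℕ}
    (hlam : StrictMono lam) (hlam' : StrictMono lam')
    (W : Triple d lam mu ≃ Fin κ) (W' : Triple d' lam' mu' ≃ Fin κ)
    (h : Setoid.ker (blkW W) = Setoid.ker (blkW W')) :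
    ∃ hd : d = d', ∀ e, lam e = lam' (Fin.cast hd e) ∧ mu e = mu' (Fin.cast hd e) := by
  obtain ⟨θ, hθ⟩ := ker_equiv _ _ (blkW_surj W) (blkW_surj W') h
  have h1 := theta_lam W W' θ hθ
  have h2 : Set.range lam = Set.range lam' := by
    ext k
    constructor
    · rintro ⟨e, rfl⟩
      exact ⟨_, h1 ⟨e, 0⟩⟩
    · rintro ⟨e, rfl⟩
      refine ⟨(θ.symm ⟨e, 0⟩).1, ?_⟩
      rw [← h1]
      simp
  obtain ⟨hd, hl⟩ := strictMono_fin_unique _ _ hlam hlam' h2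
  refine ⟨hd, fun e => ⟨hl e, ?_⟩⟩
  subst hd
  have hl' : lam = lam' := funext hl
  subst hl'
  have h3 : ∀ b, (θ b).1 = b.1 := fun b => hlam.injective (h1 b)
  have h4 := Fintype.card_congr ((Equiv.sigmaSubtype e).symm.trans
    ((θ.subtypeEquiv (p := fun b => b.1 = e) (q := fun b => b.1 = e)
      (fun b => by rw [h3])).trans (Equiv.sigmaSubtype e)))
  simp only [Fintype.card_fin] at h4
  simp only [Fin.cast_eq_self]
  omega

lemma inH_of_ker {d κ : ℕ} {lam mu : Fin d → ℕ} (hlam : StrictMono lam)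
    (E : Triple d lam mu ≃ Fin κ) (σ σ' : Equiv.Perm (Triple d lam mu))
    (h : Setoid.ker (blkW (σ.trans E)) = Setoid.ker (blkW (σ'.trans E))) :
    inH lam mu (σ⁻¹ * σ') := by
  obtain ⟨θ, hθ⟩ := ker_equiv _ _ (blkW_surj (σ'.trans E)) (blkW_surj (σ.trans E)) h.symm
  have h1 := theta_lam _ _ θ hθ
  have h2 : ∀ t : Triple d lam mu,
      (⟨((σ⁻¹ * σ') t).1, ((σ⁻¹ * σ') t).2.1⟩ : (e : Fin d) × Fin (mu e + 1))
        = θ ⟨t.1, t.2.1⟩ := by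
    intro t
    have := hθ (E (σ' t))
    rw [blkW, blkW, Equiv.symm_trans_apply, Equiv.symm_trans_apply, Equiv.symm_apply_apply,
      Equiv.symm_apply_apply] at this
    exact this
  intro e ν γ γ'
  constructor
  · have h3 := congrArg Sigma.fst (h2 ⟨e, ν, γ⟩)
    dsimp only at h3
    rw [h3]
    exact hlam.injective (h1 ⟨e, ν⟩)
  · have h3 := (h2 ⟨e, ν, γ⟩).trans (h2 ⟨e, ν, γ'⟩).symm
    exact congrArg (fun b : (e : Fin d) × Fin (mu e + 1) => (b.2 : ℕ)) h3

lemma ker_of_inH {d κ : ℕ} {lam mu : Fin d → ℕ}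
    (E : Triple d lam mu ≃ Fin κ) (σ σ' : Equiv.Perm (Triple d lam mu))
    (h : inH lam mu (σ⁻¹ * σ')) :
    Setoid.ker (blkW (σ.trans E)) = Setoid.ker (blkW (σ'.trans E)) := by
  let θ : ((e : Fin d) × Fin (mu e + 1)) → ((e : Fin d) × Fin (mu e + 1)) := fun b =>
    ⟨((σ⁻¹ * σ') ⟨b.1, b.2, 0⟩).1, ((σ⁻¹ * σ') ⟨b.1, b.2, 0⟩).2.1⟩
  have hθ : ∀ a, blkW (σ.trans E) a = θ (blkW (σ'.trans E) a) := by
    intro a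
    obtain ⟨⟨e, ν, γ⟩, rfl⟩ := (σ'.trans E).surjective a
    rw [blkW_apply]
    have h1 : (σ.trans E).symm ((σ'.trans E) ⟨e, ν, γ⟩) = (σ⁻¹ * σ') ⟨e, ν, γ⟩ := by
      simp [Equiv.Perm.mul_apply]
    unfold blkW tblk
    rw [h1]
    have h2 := (h e ν γ 0).1
    have h3 := (h e ν 0 0).1
    have h4 := (h e ν γ 0).2
    simp only [θ]
    generalize (σ⁻¹ * σ') ⟨e, ν, γ⟩ = t at *
    generalize (σ⁻¹ * σ') ⟨e, ν, 0⟩ = t' at *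
    obtain ⟨e1, ν1, γ1⟩ := t
    obtain ⟨e2, ν2, γ2⟩ := t'
    dsimp only at h2 h3 h4 ⊢
    subst h2
    subst h3
    rw [Fin.ext h4]
  have hs : Function.Surjective θ := by
    intro b
    obtain ⟨a, rfl⟩ := blkW_surj (σ.trans E) b
    exact ⟨_, (hθ a).symm⟩
  have hi : Function.Injective θ := Finite.injective_iff_surjective.2 hs
  ext a b
  rw [Setoid.ker_def, Setoid.ker_def, hθ, hθ, hi.eq_iff]

lemma shape_surj {κ : ℕ} (hκ : 0 < κ) (s : Setoid (Fin κ)) :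
    ∃ (k : ℕ) (lam mu : Fin (k + 1) → ℕ) (W : Triple (k + 1) lam mu ≃ Fin κ),
      StrictMono lam ∧ Setoid.ker (blkW W) = s := by
  classical
  let p : Fin κ → Quotient s := Quotient.mk s
  let sz : Quotient s → ℕ := fun b => Fintype.card {a // p a = b}
  have hsz : ∀ b, 0 < sz b := by
    intro b
    obtain ⟨a, rfl⟩ := Quotient.mk_surjective b
    exact Fintype.card_pos_iff.2 ⟨⟨a, rfl⟩⟩
  let S : Finset ℕ := univ.image (fun b => sz b - 1)
  have hSne : S.Nonempty := ⟨_, mem_image_of_mem _ (mem_univ (p ⟨0, hκ⟩))⟩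
  obtain ⟨k, hk⟩ := Nat.exists_eq_add_one.2 (Finset.card_pos.2 hSne)
  let lam : Fin (k + 1) → ℕ := S.orderEmbOfFin hk
  have hlam : StrictMono lam := (S.orderEmbOfFin hk).strictMono
  let mu : Fin (k + 1) → ℕ := fun e => Fintype.card {b // sz b - 1 = lam e} - 1
  have hmu : ∀ e, Fintype.card {b // sz b - 1 = lam e} = mu e + 1 := by
    intro e
    have h1 : lam e ∈ S := S.orderEmbOfFin_mem hk e
    obtain ⟨b, -, hb⟩ := mem_image.1 h1
    have : 0 < Fintype.card {b // sz b - 1 = lam e} := Fintype.card_pos_iff.2 ⟨⟨b, hb⟩⟩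
    simp only [mu]
    omega
  let β : ∀ e, {b // sz b - 1 = lam e} ≃ Fin (mu e + 1) :=
    fun e => Fintype.equivFinOfCardEq (hmu e)
  let τ : ∀ (e) (ν : Fin (mu e + 1)), {a // p a = ((β e).symm ν : Quotient s)} ≃ Fin (lam e + 1) :=
    fun e ν => Fintype.equivFinOfCardEq (by
      have h1 := ((β e).symm ν).2
      have h2 := hsz ((β e).symm ν)
      change sz _ = _
      omega)
  let W0 : Triple (k + 1) lam mu → Fin κ := fun t => (τ t.1 t.2.1).symm t.2.2
  have hW0 : ∀ t, p (W0 t) = ((β t.1).symm t.2.1 : Quotient s) :=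
    fun t => ((τ t.1 t.2.1).symm t.2.2).2
  have hβ : ∀ e ν e' ν', (((β e).symm ν : _) : Quotient s) = ((β e').symm ν' : _) →
      (⟨e, ν⟩ : (e : Fin (k + 1)) × Fin (mu e + 1)) = ⟨e', ν'⟩ := by
    intro e ν e' ν' h
    have h1 := ((β e).symm ν).2
    have h2 := ((β e').symm ν').2
    have h3 : e = e' := hlam.injective (by rw [← h1, ← h2, h])
    subst h3
    have := (β e).symm.injective (Subtype.ext h)
    rw [this]
  have hinj : Function.Injective W0 := by
    rintro ⟨e, ν, γ⟩ ⟨e', ν', γ'⟩ h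
    have h1 := hβ e ν e' ν' (by rw [← hW0 ⟨e, ν, γ⟩, ← hW0 ⟨e', ν', γ'⟩, h])
    cases h1
    have := (τ e ν).symm.injective (Subtype.ext h)
    have h5 : γ = γ' := this
    rw [h5]
  have hsurj : Function.Surjective W0 := by
    intro a
    have h1 : sz (p a) - 1 ∈ Set.range lam := by
      have : Set.range lam = S := S.range_orderEmbOfFin hk
      rw [this]
      exact mem_image_of_mem _ (mem_univ _)
    obtain ⟨e, he⟩ := h1
    let ν := β e ⟨p a, he.symm⟩
    have hν : p a = ((β e).symm ν : Quotient s) := by simp [ν]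
    refine ⟨⟨e, ν, τ e ν ⟨a, hν⟩⟩, ?_⟩
    simp [W0]
  let W : Triple (k + 1) lam mu ≃ Fin κ := Equiv.ofBijective W0 ⟨hinj, hsurj⟩
  refine ⟨k, lam, mu, W, hlam, ?_⟩
  ext a b
  obtain ⟨⟨e, ν, γ⟩, rfl⟩ := W.surjective a
  obtain ⟨⟨e', ν', γ'⟩, rfl⟩ := W.surjective b
  rw [Setoid.ker_def, blkW_apply, blkW_apply]
  have h1 : s (W ⟨e, ν, γ⟩) (W ⟨e', ν', γ'⟩) ↔ p (W0 ⟨e, ν, γ⟩) = p (W0 ⟨e', ν', γ'⟩) :=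
    Quotient.eq.symm
  rw [h1, hW0, hW0]
  constructor
  · intro h
    cases h
    rfl
  · exact hβ e ν e' ν'

open Classical in
/-- The setoid attached to a shape and a permutation. -/
noncomputable def shSetoid (κ d : ℕ) (lam mu : Fin d → ℕ) (σ : Equiv.Perm (Triple d lam mu)) :
    Setoid (Fin κ) :=
  if h : ∑ e, (mu e + 1) * (lam e + 1) = κ then
    Setoid.ker (blkW (σ.trans (encEquiv lam mu h))) else ⊤

lemma inner_eq {n m κ : ℕ} (g : Fin m → (Fin n → ℝ) → ℝ) (f : (Fin m → ℝ) → ℝ)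
    (hg : ∀ l, ContDiff ℝ (⊤ : ℕ∞) (g l)) (hf : ContDiff ℝ (⊤ : ℕ∞) f) (hκ : 0 < κ)
    (i : Fin κ → Fin n) (x : Fin n → ℝ)
    [∀ s : Setoid (Fin κ), Fintype (Quotient s)]
    (d : ℕ) (lam' mu' : Fin d → ℕ) (h : ∑ e, (mu' e + 1) * (lam' e + 1) = κ)
    (R : Finset (Equiv.Perm (Triple d lam' mu'))) :
    ∑ l : ((e : Fin d) × Fin (mu' e + 1)) → Fin m,
          pdfl (blkList l) f (fun l' => g l' x)
            * ∑ σ ∈ R,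
                ∏ e : Fin d, ∏ ν : Fin (mu' e + 1),
                  pdl (List.ofFn (fun γ : Fin (lam' e + 1) =>
                      if h : encT lam' mu' (σ ⟨e, (ν, γ)⟩) < κ
                      then i ⟨encT lam' mu' (σ ⟨e, (ν, γ)⟩), h⟩
                      else i ⟨0, hκ⟩))
                    (g (l ⟨e, ν⟩)) x
    = ∑ σ ∈ R, fdbTerm g f i x (Quotient (shSetoid κ d lam' mu' σ)) (Quotient.mk _) := by
  classical
  simp only [Finset.mul_sum]
  rw [Finset.sum_comm]
  refine Finset.sum_congr rfl fun σ _ => ?_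
  have h1 : fdbTerm g f i x (Quotient (shSetoid κ d lam' mu' σ)) (Quotient.mk _) =
      fdbTerm g f i x _ (blkW (σ.trans (encEquiv lam' mu' h))) := by
    symm
    apply fdbTerm_ker
    · exact blkW_surj _
    · exact Quotient.mk_surjective
    · refine Eq.trans ?_ (Setoid.ker_mk_eq (shSetoid κ d lam' mu' σ)).symm
      rw [shSetoid, dif_pos h]
  rw [h1]
  unfold fdbTerm
  refine Finset.sum_congr (by ext; simp) fun l _ => ?_
  congr 1
  · rw [pdfl_eq_pdl, pdl_eq_pdm hf _ _ (coe_blkList l)]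
  · rw [Fintype.prod_sigma]
    refine Finset.prod_congr rfl fun e _ => Finset.prod_congr rfl fun ν _ => ?_
    rw [pdl_eq_pdm (hg _) _ _ (ofFn_coe _)]
    congr 1
    trans Multiset.map i
      ((univ.filter (fun a => blkW (σ.trans (encEquiv lam' mu' h)) a = ⟨e, ν⟩)).val)
    · rw [blkW_filter, Finset.map_val, Multiset.map_map]
      congr 1
      funext γ
      have h2 := encEquiv_apply lam' mu' h (σ ⟨e, (ν, γ)⟩)
      have h3 : encT lam' mu' (σ ⟨e, (ν, γ)⟩) < κ := by rw [← h2]; exact Fin.is_lt _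
      rw [dif_pos h3]
      simp only [Function.comp_apply, Function.Embedding.coeFn_mk, Equiv.trans_apply]
      congr 1
      exact Fin.ext h2.symm
    · congr!

end FdBHelpers

/-- The general multivariate Faà di Bruno formula for
`h(x) = f(g¹(x),…,gᵐ(x))`, `gʲ : ℝⁿ → ℝ`, `f : ℝᵐ → ℝ`, for an arbitrary choice `R` of
complete sets of representatives of the left cosets `S_κ / H`. -/
theorem faa_di_bruno_general_multivariate
    (n m : ℕ) (hn : 0 < n) (hm : 0 < m)
    (g : Fin m → (Fin n → ℝ) → ℝ) (f : (Fin m → ℝ) → ℝ)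
    (hg : ∀ l, ContDiff ℝ (⊤ : ℕ∞) (g l)) (hf : ContDiff ℝ (⊤ : ℕ∞) f)
    (κ : ℕ) (hκ : 0 < κ) (i : Fin κ → Fin n)
    (R : ∀ (d : ℕ) (lam' mu' : Fin d → ℕ), Finset (Equiv.Perm (Triple d lam' mu')))
    (hR : ∀ (d : ℕ) (lam' mu' : Fin d → ℕ) (σ : Equiv.Perm (Triple d lam' mu')),
      ∃! ρ, ρ ∈ R d lam' mu' ∧ inH lam' mu' (σ⁻¹ * ρ))
    (x : Fin n → ℝ) :
    pdl (List.ofFn i) (fun z => f (fun l => g l z)) x =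
      ∑ dm1 ∈ Finset.range κ,
        ∑ lam' ∈ (Fintype.piFinset fun _ : Fin (dm1 + 1) => Finset.range κ).filter
            (fun lam' => ∀ a b : Fin (dm1 + 1), a < b → lam' a < lam' b),
        ∑ mu' ∈ (Fintype.piFinset fun _ : Fin (dm1 + 1) => Finset.range κ).filter
            (fun mu' => ∑ e, (mu' e + 1) * (lam' e + 1) = κ),
        ∑ l : ((e : Fin (dm1 + 1)) × Fin (mu' e + 1)) → Fin m,
          pdfl (blkList l) f (fun l' => g l' x)
            * ∑ σ ∈ R (dm1 + 1) lam' mu',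
                ∏ e : Fin (dm1 + 1), ∏ ν : Fin (mu' e + 1),
                  pdl (List.ofFn (fun γ : Fin (lam' e + 1) =>
                      if h : encT lam' mu' (σ ⟨e, (ν, γ)⟩) < κ
                      then i ⟨encT lam' mu' (σ ⟨e, (ν, γ)⟩), h⟩
                      else i ⟨0, hκ⟩))
                    (g (l ⟨e, ν⟩)) x := by
  classical
  have hfin : Finite (Setoid (Fin κ)) := Finite.of_surjective _ (ofpSetoid_surjective κ)
  let _ : Fintype (Setoid (Fin κ)) := Fintype.ofFinite _
  rw [lhs_eq_setoid g f hg hf]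
  symm
  trans ∑ dm1 ∈ Finset.range κ,
        ∑ lam' ∈ (Fintype.piFinset fun _ : Fin (dm1 + 1) => Finset.range κ).filter
            (fun lam' => ∀ a b : Fin (dm1 + 1), a < b → lam' a < lam' b),
        ∑ mu' ∈ (Fintype.piFinset fun _ : Fin (dm1 + 1) => Finset.range κ).filter
            (fun mu' => ∑ e, (mu' e + 1) * (lam' e + 1) = κ),
        ∑ σ ∈ R (dm1 + 1) lam' mu',
          fdbTerm g f i x (Quotient (shSetoid κ (dm1 + 1) lam' mu' σ)) (Quotient.mk _)
  · refine Finset.sum_congr rfl fun dm1 _ => Finset.sum_congr rfl fun lam' _ =>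
      Finset.sum_congr rfl fun mu' hmu' => ?_
    exact inner_eq g f hg hf hκ i x (dm1 + 1) lam' mu' (Finset.mem_filter.1 hmu').2 _
  simp only [Finset.sum_sigma']
  refine Finset.sum_bij (fun t _ => shSetoid κ (t.1 + 1) t.2.1 t.2.2.1 t.2.2.2) ?_ ?_ ?_ ?_
  · intro t _
    exact Finset.mem_univ _
  · rintro ⟨k, lam, mu, σ⟩ ht ⟨k', lam', mu', σ'⟩ ht' h
    simp only [Finset.mem_sigma, Finset.mem_filter] at ht ht'
    obtain ⟨-, ⟨-, hl⟩, ⟨-, hm⟩, hσ⟩ := ht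
    obtain ⟨-, ⟨-, hl'⟩, ⟨-, hm'⟩, hσ'⟩ := ht'
    have hl2 : StrictMono lam := fun a b hab => hl a b hab
    have hl2' : StrictMono lam' := fun a b hab => hl' a b hab
    dsimp only at h
    rw [shSetoid, shSetoid, dif_pos hm, dif_pos hm'] at h
    obtain ⟨hd, hs⟩ := shape_inj hl2 hl2' _ _ h
    have hd' : k = k' := by omega
    subst hd'
    have e1 : lam = lam' := funext fun e => (hs e).1
    have e2 : mu = mu' := funext fun e => (hs e).2
    subst e1
    subst e2
    have h1 := inH_of_ker hl2 _ σ σ' h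
    have h0 : inH lam mu (σ⁻¹ * σ) := by
      rw [inv_mul_cancel]
      intro e ν γ γ'
      exact ⟨rfl, rfl⟩
    have := (hR _ _ _ σ).unique ⟨hσ, h0⟩ ⟨hσ', h1⟩
    rw [this]
  · intro s _
    obtain ⟨k, lam, mu, W, hlam, hW⟩ := shape_surj hκ s
    have hsum : ∑ e, (mu e + 1) * (lam e + 1) = κ := by
      have := Fintype.card_congr W
      simpa using this
    let σ : Equiv.Perm (Triple (k + 1) lam mu) := W.trans (encEquiv lam mu hsum).symm
    have hσ : σ.trans (encEquiv lam mu hsum) = W := by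
      ext t; simp [σ]
    obtain ⟨ρ, ⟨hρ, hH⟩, -⟩ := hR _ _ _ σ
    have hle : ∀ e, (mu e + 1) * (lam e + 1) ≤ κ := by
      intro e
      rw [← hsum]
      exact Finset.single_le_sum (f := fun e => (mu e + 1) * (lam e + 1))
        (fun _ _ => Nat.zero_le _) (Finset.mem_univ e)
    have hk : k + 1 ≤ κ := by
      calc k + 1 = ∑ e : Fin (k + 1), 1 := by simp
        _ ≤ ∑ e, (mu e + 1) * (lam e + 1) :=
          Finset.sum_le_sum fun e _ => Nat.succ_le_of_lt (by positivity)
        _ = κ := hsum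
    refine ⟨⟨k, lam, mu, ρ⟩, ?_, ?_⟩
    · simp only [Finset.mem_sigma, Finset.mem_filter, Fintype.mem_piFinset, Finset.mem_range]
      refine ⟨by omega, ⟨fun e => ?_, fun a b hab => hlam hab⟩, ⟨fun e => ?_, hsum⟩, hρ⟩
      · have := hle e
        nlinarith [Nat.zero_le (mu e * (lam e + 1))]
      · have := hle e
        nlinarith [Nat.zero_le (lam e * (mu e + 1))]
    · dsimp only
      rw [shSetoid, dif_pos hsum, ← ker_of_inH _ σ ρ hH, hσ, hW]
  · intro t _
    rfl
end

section
/- For every integer κ ≥ 1, evaluating the prolongation coefficient 𝐘_κ at y_2 = y_3 = ⋯ = y_κ = 0 (y_1 arbitrary) yields exactly: 𝒴_{x^κ} + Σ_{λ=1}^{κ} [ C(κ,λ) · 𝒴_{x^{κ−λ} y^λ} − C(κ,λ−1) · 𝒳_{x^{κ−λ+1} y^{λ−1}} ] · (y_1)^λ − 𝒳_{y^κ} · (y_1)^{κ+1}, where C(p,q) denotes the binomial coefficient. Equivalently, in the expansion of 𝐘_κ as a polynomial in the jet variables, the monomials involving only y_1 are precisely these, with binomial-coefficient coefficients. -/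
/-- Partial derivative in the first variable of a function of (x,y). -/
noncomputable def pdx (F : ℝ → ℝ → ℝ) : ℝ → ℝ → ℝ := fun x y => deriv (fun t => F t y) x

/-- Partial derivative in the second variable of a function of (x,y). -/
noncomputable def pdy (F : ℝ → ℝ → ℝ) : ℝ → ℝ → ℝ := fun x y => deriv (fun t => F x t) y

/-- Mixed partial derivative `∂^{a+b} F / ∂x^a ∂y^b`. -/
noncomputable def pd (a b : ℕ) (F : ℝ → ℝ → ℝ) : ℝ → ℝ → ℝ := pdx^[a] (pdy^[b] F)

/-- The total differentiation operator `D^λ`.  The state is `(x, j)` where `j 0` plays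
the role of the dependent variable `y` and `j c` (`c ≥ 1`) is the jet variable `y_c`.
`D^λ F = ∂F/∂x + y_1 ∂F/∂y + y_2 ∂F/∂y_1 + ⋯ + y_λ ∂F/∂y_{λ-1}`. -/
noncomputable def totalD (lam : ℕ) (F : ℝ → (ℕ → ℝ) → ℝ) : ℝ → (ℕ → ℝ) → ℝ :=
  fun x j => deriv (fun t => F t j) x
    + ∑ c ∈ Finset.range lam, j (c + 1) * deriv (fun t => F x (Function.update j c t)) (j c)

/-- The prolongation coefficients `𝐘_λ`:  `prolong X Y 0 = 𝒴`,
`𝐘_{λ+1} = D^{λ+1}(𝐘_λ) − D¹(𝒳)·y_{λ+1}` (so `prolong X Y 1 = D¹(𝒴) − D¹(𝒳)·y_1`). -/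
noncomputable def prolong (X Y : ℝ → ℝ → ℝ) : ℕ → ℝ → (ℕ → ℝ) → ℝ
  | 0 => fun x j => Y x (j 0)
  | l + 1 => fun x j =>
      totalD (l + 1) (prolong X Y l) x j
        - totalD 1 (fun x' j' => X x' (j' 0)) x j * j (l + 1)

/-- The submodule of smooth functions of two real variables. -/
def smoothSub : Submodule ℝ (ℝ → ℝ → ℝ) where
  carrier := {F | ContDiff ℝ (⊤ : ℕ∞) (fun p : ℝ × ℝ => F p.1 p.2)}
  add_mem' := by
    intro a b ha hb
    rw [Set.mem_ofPred_eq] at ha hb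
    exact ha.add hb
  zero_mem' := by
    rw [Set.mem_ofPred_eq]
    exact contDiff_const (c := (0 : ℝ))
  smul_mem' := by
    intro c a ha
    rw [Set.mem_ofPred_eq] at ha
    exact (contDiff_const (c := c)).mul ha

lemma hasDeriv_fst {F : ℝ → ℝ → ℝ} (hF : ContDiff ℝ (⊤ : ℕ∞) (fun p : ℝ × ℝ => F p.1 p.2))
    (x y : ℝ) : HasDerivAt (fun t => F t y)
      (fderiv ℝ (fun p : ℝ × ℝ => F p.1 p.2) (x, y) (1, 0)) x := by
  have h1 : HasFDerivAt (fun p : ℝ × ℝ => F p.1 p.2) _ (x, y) :=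
    ((hF.differentiable (by simp)) (x, y)).hasFDerivAt
  exact h1.comp_hasDerivAt x ((hasDerivAt_id x).prodMk (hasDerivAt_const x y))

lemma hasDeriv_snd {F : ℝ → ℝ → ℝ} (hF : ContDiff ℝ (⊤ : ℕ∞) (fun p : ℝ × ℝ => F p.1 p.2))
    (x y : ℝ) : HasDerivAt (fun t => F x t)
      (fderiv ℝ (fun p : ℝ × ℝ => F p.1 p.2) (x, y) (0, 1)) y := by
  have h1 : HasFDerivAt (fun p : ℝ × ℝ => F p.1 p.2) _ (x, y) :=
    ((hF.differentiable (by simp)) (x, y)).hasFDerivAt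
  exact h1.comp_hasDerivAt y ((hasDerivAt_const y x).prodMk (hasDerivAt_id y))

lemma smooth_fderiv_apply {G : ℝ × ℝ → ℝ} (hG : ContDiff ℝ (⊤ : ℕ∞) G) (v : ℝ × ℝ) :
    ContDiff ℝ (⊤ : ℕ∞) (fun p => fderiv ℝ G p v) :=
  (hG.fderiv_right (m := ((⊤ : ℕ∞) : WithTop ℕ∞)) (by simp)).clm_apply contDiff_const

lemma pdx_eq {F : ℝ → ℝ → ℝ} (hF : ContDiff ℝ (⊤ : ℕ∞) (fun p : ℝ × ℝ => F p.1 p.2)) :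
    pdx F = fun x y => fderiv ℝ (fun p : ℝ × ℝ => F p.1 p.2) (x, y) (1, 0) := by
  funext x y
  exact (hasDeriv_fst hF x y).deriv

lemma pdy_eq {F : ℝ → ℝ → ℝ} (hF : ContDiff ℝ (⊤ : ℕ∞) (fun p : ℝ × ℝ => F p.1 p.2)) :
    pdy F = fun x y => fderiv ℝ (fun p : ℝ × ℝ => F p.1 p.2) (x, y) (0, 1) := by
  funext x y
  exact (hasDeriv_snd hF x y).deriv

lemma pdx_smooth {F : ℝ → ℝ → ℝ} (hF : F ∈ smoothSub) : pdx F ∈ smoothSub := by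
  rw [pdx_eq hF]
  exact smooth_fderiv_apply hF _

lemma pdy_smooth {F : ℝ → ℝ → ℝ} (hF : F ∈ smoothSub) : pdy F ∈ smoothSub := by
  rw [pdy_eq hF]
  exact smooth_fderiv_apply hF _

lemma diff_fst {F : ℝ → ℝ → ℝ} (hF : F ∈ smoothSub) (x y : ℝ) :
    DifferentiableAt ℝ (fun t => F t y) x := (hasDeriv_fst hF x y).differentiableAt

lemma diff_snd {F : ℝ → ℝ → ℝ} (hF : F ∈ smoothSub) (x y : ℝ) :
    DifferentiableAt ℝ (fun t => F x t) y := (hasDeriv_snd hF x y).differentiableAt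

lemma pd_comm {F : ℝ → ℝ → ℝ} (hF : F ∈ smoothSub) : pdx (pdy F) = pdy (pdx F) := by
  rw [pdx_eq (pdy_smooth hF), pdy_eq (pdx_smooth hF), pdx_eq hF, pdy_eq hF]
  funext x y
  have hF' : ContDiff ℝ (⊤ : ℕ∞) (fun p : ℝ × ℝ => F p.1 p.2) := hF
  have hd : DifferentiableAt ℝ (fderiv ℝ (fun p : ℝ × ℝ => F p.1 p.2)) (x, y) :=
    (hF'.fderiv_right (m := ((⊤ : ℕ∞) : WithTop ℕ∞)) (by simp)).differentiable (by simp) _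
  have hs : IsSymmSndFDerivAt ℝ (fun p : ℝ × ℝ => F p.1 p.2) (x, y) :=
    (contDiff_infty.1 hF' 2).contDiffAt.isSymmSndFDerivAt (by simp)
  have key : ∀ v w : ℝ × ℝ,
      fderiv ℝ (fun p : ℝ × ℝ => fderiv ℝ (fun p : ℝ × ℝ => F p.1 p.2) (p.1, p.2) v) (x, y) w
      = fderiv ℝ (fderiv ℝ (fun p : ℝ × ℝ => F p.1 p.2)) (x, y) w v := by
    intro v w
    have := (hd.hasFDerivAt.clm_apply (hasFDerivAt_const v (x, y))).fderiv
    simp only [Prod.mk.eta]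
    rw [this]
    simp
  rw [key, key]
  exact hs.eq _ _

/-- `∂/∂x` on smooth functions. -/
noncomputable def dxL : smoothSub →ₗ[ℝ] smoothSub where
  toFun F := ⟨pdx F.1, pdx_smooth F.2⟩
  map_add' F G := by
    ext x y
    exact deriv_add (diff_fst F.2 x y) (diff_fst G.2 x y)
  map_smul' c F := by
    ext x y
    exact deriv_const_mul c (diff_fst F.2 x y)

/-- `∂/∂y` on smooth functions. -/
noncomputable def dyL : smoothSub →ₗ[ℝ] smoothSub where
  toFun F := ⟨pdy F.1, pdy_smooth F.2⟩
  map_add' F G := by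
    ext x y
    exact deriv_add (diff_snd F.2 x y) (diff_snd G.2 x y)
  map_smul' c F := by
    ext x y
    exact deriv_const_mul c (diff_snd F.2 x y)

lemma dxL_dyL_commute : Commute dxL dyL := by
  apply LinearMap.ext
  intro F
  exact Subtype.ext (pd_comm F.2)

lemma dxL_pow (n : ℕ) (F : smoothSub) : ((dxL ^ n) F).1 = pdx^[n] F.1 := by
  induction n with
  | zero => rfl
  | succ n ih =>
    rw [pow_succ', Function.iterate_succ_apply', ← ih]
    rfl

lemma dyL_pow (n : ℕ) (F : smoothSub) : ((dyL ^ n) F).1 = pdy^[n] F.1 := by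
  induction n with
  | zero => rfl
  | succ n ih =>
    rw [pow_succ', Function.iterate_succ_apply', ← ih]
    rfl

/-- `∂/∂x + p ∂/∂y` with constant `p`. -/
noncomputable def eL (p : ℝ) : smoothSub →ₗ[ℝ] smoothSub := p • dyL + dxL

lemma eL_apply (p : ℝ) (F : smoothSub) (x y : ℝ) :
    (eL p F).1 x y = deriv (fun t => F.1 t y) x + p * deriv (fun t => F.1 x t) y := by
  rw [add_comm]
  rfl

lemma eval_sum (s : Finset ℕ) (f : ℕ → smoothSub) (x y : ℝ) :
    (∑ i ∈ s, f i).1 x y = ∑ i ∈ s, (f i).1 x y := by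
  simp [Finset.sum_apply]

lemma eL_pow (p : ℝ) (n : ℕ) (F : smoothSub) (x y : ℝ) :
    ((eL p ^ n) F).1 x y
      = ∑ m ∈ Finset.range (n + 1), (n.choose m : ℝ) * pd (n - m) m F.1 x y * p ^ m := by
  have hc : Commute (p • dyL) dxL := (dxL_dyL_commute.symm).smul_left p
  rw [eL, hc.add_pow, LinearMap.sum_apply, eval_sum]
  refine Finset.sum_congr rfl fun m _ => ?_
  have h : ((p • dyL) ^ m * dxL ^ (n - m) * (n.choose m : smoothSub →ₗ[ℝ] smoothSub))
      = ((n.choose m : ℝ) * p ^ m) • (dxL ^ (n - m) * dyL ^ m) := by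
    rw [smul_pow, (dxL_dyL_commute.pow_pow (n - m) m).eq, ← nsmul_eq_mul', smul_mul_assoc,
      ← Nat.cast_smul_eq_nsmul ℝ, smul_smul]
  rw [h]
  have h2 : ((dxL ^ (n - m) * dyL ^ m) F).1 = pd (n - m) m F.1 := by
    rw [Module.End.mul_apply, dxL_pow, dyL_pow]
    rfl
  rw [← h2]
  change ((n.choose m : ℝ) * p ^ m) * _ = _
  ring

lemma prolong_eq (X Y : smoothSub) (κ : ℕ) (hκ : 1 ≤ κ) :
    ∀ (x : ℝ) (j : ℕ → ℝ), (∀ c : ℕ, 2 ≤ c → c ≤ κ → j c = 0) →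
    prolong X.1 Y.1 κ x j
      = ((eL (j 1) ^ κ) Y).1 x (j 0) - j 1 * ((eL (j 1) ^ κ) X).1 x (j 0) := by
  induction κ, hκ using Nat.le_induction with
  | base =>
    intro x j _
    rw [pow_one, eL_apply, eL_apply]
    simp [prolong, totalD]
    ring
  | succ κ hκ ih =>
    intro x j hj
    have hj' : ∀ c : ℕ, 2 ≤ c → c ≤ κ → j c = 0 := fun c h1 h2 => hj c h1 (by omega)
    change totalD (κ + 1) (prolong X.1 Y.1 κ) x j
      - totalD 1 (fun x' j' => X.1 x' (j' 0)) x j * j (κ + 1) = _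
    rw [hj (κ + 1) (by omega) le_rfl, mul_zero, sub_zero, totalD,
      Finset.sum_range_succ', Finset.sum_eq_zero, zero_add]
    · have e1 : (fun t => prolong X.1 Y.1 κ t j) = fun t =>
          ((eL (j 1) ^ κ) Y).1 t (j 0) - j 1 * ((eL (j 1) ^ κ) X).1 t (j 0) :=
        funext fun t => ih t j hj'
      have e2 : (fun t => prolong X.1 Y.1 κ x (Function.update j 0 t)) = fun t =>
          ((eL (j 1) ^ κ) Y).1 x t - j 1 * ((eL (j 1) ^ κ) X).1 x t := by
        funext t
        rw [ih x (Function.update j 0 t)]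
        · simp
        · intro c h1 h2
          rw [Function.update_of_ne (by omega)]
          exact hj' c h1 h2
      rw [e1, e2, deriv_fun_sub (diff_fst (Subtype.prop _) _ _)
          ((diff_fst (Subtype.prop _) _ _).const_mul _),
        deriv_fun_sub (diff_snd (Subtype.prop _) _ _)
          ((diff_snd (Subtype.prop _) _ _).const_mul _),
        deriv_const_mul _ (diff_fst (Subtype.prop _) _ _),
        deriv_const_mul _ (diff_snd (Subtype.prop _) _ _),
        pow_succ', Module.End.mul_apply, Module.End.mul_apply, eL_apply, eL_apply]
      ring
    · intro c hc
      rw [Finset.mem_range] at hc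
      rw [hj (c + 1 + 1) (by omega) (by omega), zero_mul]

/-- Evaluating `𝐘_κ` at `y_2 = ⋯ = y_κ = 0` (with `y_1` arbitrary) yields the
binomial-coefficient part of the closed formula. -/
theorem prolongation_pure_first_jet_part
    (X Y : ℝ → ℝ → ℝ)
    (hX : ContDiff ℝ (⊤ : ℕ∞) (fun p : ℝ × ℝ => X p.1 p.2))
    (hY : ContDiff ℝ (⊤ : ℕ∞) (fun p : ℝ × ℝ => Y p.1 p.2))
    (κ : ℕ) (hκ : 1 ≤ κ) (x : ℝ) (j : ℕ → ℝ)
    (hj : ∀ c : ℕ, 2 ≤ c → c ≤ κ → j c = 0) :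
    prolong X Y κ x j =
      pd κ 0 Y x (j 0)
      + ∑ lam ∈ Finset.Icc 1 κ,
          ((κ.choose lam : ℝ) * pd (κ - lam) lam Y x (j 0)
            - (κ.choose (lam - 1) : ℝ) * pd (κ - lam + 1) (lam - 1) X x (j 0))
          * (j 1) ^ lam
      - pd 0 κ X x (j 0) * (j 1) ^ (κ + 1) := by
  have h := prolong_eq ⟨X, hX⟩ ⟨Y, hY⟩ κ hκ x j hj
  rw [eL_pow, eL_pow] at h
  simp only at h
  have hs : ∀ f : ℕ → ℝ, ∑ lam ∈ Finset.Icc 1 κ, f lam = ∑ m ∈ Finset.range κ, f (m + 1) := by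
    intro f
    rw [Finset.range_eq_Ico, Finset.sum_Ico_add' f 0 κ 1]
    rfl
  have hx : ∑ m ∈ Finset.range κ, ((κ.choose (m + 1) : ℝ) * pd (κ - (m + 1)) (m + 1) Y x (j 0)
            - (κ.choose (m + 1 - 1) : ℝ) * pd (κ - (m + 1) + 1) (m + 1 - 1) X x (j 0))
          * (j 1) ^ (m + 1)
      = ∑ m ∈ Finset.range κ, (κ.choose (m + 1) : ℝ) * pd (κ - (m + 1)) (m + 1) Y x (j 0)
          * (j 1) ^ (m + 1)
        - j 1 * ∑ m ∈ Finset.range κ, (κ.choose m : ℝ) * pd (κ - m) m X x (j 0) * (j 1) ^ m := by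
    rw [Finset.mul_sum, ← Finset.sum_sub_distrib]
    refine Finset.sum_congr rfl fun m hm => ?_
    rw [Finset.mem_range] at hm
    rw [Nat.add_sub_cancel, show κ - (m + 1) + 1 = κ - m by omega]
    ring
  rw [h, hs, hx, Finset.sum_range_succ', Finset.sum_range_succ _ κ]
  simp only [Nat.choose_zero_right, Nat.choose_self, Nat.sub_self, Nat.sub_zero, Nat.cast_one,
    pow_zero]
  ring
end

section
/- For every integer κ ≥ 4, write 𝐘_κ uniquely as a polynomial in the jet variables y_1, …, y_κ with coefficients C^∞ functions of (x,y). Then: the constant term is 𝒴_{x^κ}; the coefficient of y_1 is C(κ,1)·𝒴_{x^{κ−1}y} − 𝒳_{x^κ}; the coefficient of y_2 is C(κ,2)·𝒴_{x^{κ−2}y} − C(κ,1)·𝒳_{x^{κ−1}}; the coefficient of y_{κ−2} is C(κ,2)·𝒴_{x^2 y} − C(κ,3)·𝒳_{x^3}; the coefficient of y_{κ−1} is C(κ,1)·𝒴_{xy} − C(κ,2)·𝒳_{x^2}; the coefficient of y_1·y_{κ−1} is C(κ,1)·𝒴_{y^2} − κ²·𝒳_{xy}; the coefficient of y_2·y_{κ−1}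 is −C(κ+1,2)·𝒳_y; the coefficient of y_κ is 𝒴_y − C(κ,1)·𝒳_x; and the coefficient of y_1·y_κ is −C(κ+1,1)·𝒳_y. Here C(p,q) denotes the binomial coefficient p!/(q!(p−q)!). -/
/-- Partial derivative with respect to the jet variable `y_a` (where `j 0` is `y`). -/
noncomputable def jd (a : ℕ) (F : ℝ → (ℕ → ℝ) → ℝ) : ℝ → (ℕ → ℝ) → ℝ :=
  fun x j => deriv (fun t => F x (Function.update j a t)) (j a)


open scoped ContDiff

namespace Prol

abbrev Fn := ℝ → (ℕ → ℝ) → ℝ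

def S (g : ℝ → ℝ → ℝ) : Prop := ContDiff ℝ (⊤ : ℕ∞) (fun p : ℝ × ℝ => g p.1 p.2)

lemma pdx_eq {g : ℝ → ℝ → ℝ} (hg : S g) (x y : ℝ) :
    pdx g x y = fderiv ℝ (fun p : ℝ × ℝ => g p.1 p.2) (x, y) (1, 0) := by
  have h1 : HasFDerivAt (fun p : ℝ × ℝ => g p.1 p.2) _ (x, y) :=
    ((hg.differentiable (by simp)) (x, y)).hasFDerivAt
  have h2 : HasDerivAt (fun t : ℝ => (t, y)) ((1 : ℝ), (0 : ℝ)) x :=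
    (hasDerivAt_id x).prodMk (hasDerivAt_const x y)
  exact (h1.comp_hasDerivAt x h2).deriv

lemma pdy_eq {g : ℝ → ℝ → ℝ} (hg : S g) (x y : ℝ) :
    pdy g x y = fderiv ℝ (fun p : ℝ × ℝ => g p.1 p.2) (x, y) (0, 1) := by
  have h1 : HasFDerivAt (fun p : ℝ × ℝ => g p.1 p.2) _ (x, y) :=
    ((hg.differentiable (by simp)) (x, y)).hasFDerivAt
  have h2 : HasDerivAt (fun t : ℝ => (x, t)) ((0 : ℝ), (1 : ℝ)) y :=
    (hasDerivAt_const y x).prodMk (hasDerivAt_id y)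
  exact (h1.comp_hasDerivAt y h2).deriv

lemma S_fderiv {g : ℝ → ℝ → ℝ} (hg : S g) :
    ContDiff ℝ (⊤ : ℕ∞) (fderiv ℝ (fun p : ℝ × ℝ => g p.1 p.2)) :=
  ContDiff.fderiv_right (m := (⊤ : ℕ∞)) hg (by simp)

lemma S.pdx {g : ℝ → ℝ → ℝ} (hg : S g) : S (pdx g) := by
  have : (fun p : ℝ × ℝ => _root_.pdx g p.1 p.2)
      = fun p => fderiv ℝ (fun p : ℝ × ℝ => g p.1 p.2) p (1, 0) := by
    funext p; exact pdx_eq hg p.1 p.2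
  unfold S; rw [this]
  exact (S_fderiv hg).clm_apply contDiff_const

lemma S.pdy {g : ℝ → ℝ → ℝ} (hg : S g) : S (pdy g) := by
  have : (fun p : ℝ × ℝ => _root_.pdy g p.1 p.2)
      = fun p => fderiv ℝ (fun p : ℝ × ℝ => g p.1 p.2) p (0, 1) := by
    funext p; exact pdy_eq hg p.1 p.2
  unfold S; rw [this]
  exact (S_fderiv hg).clm_apply contDiff_const

lemma pd_comm {g : ℝ → ℝ → ℝ} (hg : S g) : pdx (pdy g) = pdy (pdx g) := by
  funext x y
  rw [pdx_eq hg.pdy, pdy_eq hg.pdx]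
  have e1 : (fun p : ℝ × ℝ => pdx g p.1 p.2)
      = fun p => fderiv ℝ (fun p : ℝ × ℝ => g p.1 p.2) p (1, 0) := by
    funext p; exact pdx_eq hg p.1 p.2
  have e2 : (fun p : ℝ × ℝ => pdy g p.1 p.2)
      = fun p => fderiv ℝ (fun p : ℝ × ℝ => g p.1 p.2) p (0, 1) := by
    funext p; exact pdy_eq hg p.1 p.2
  have hd : DifferentiableAt ℝ (fderiv ℝ (fun p : ℝ × ℝ => g p.1 p.2)) (x, y) :=
    (S_fderiv hg).differentiable (by simp) _
  have hs : IsSymmSndFDerivAt ℝ (fun p : ℝ × ℝ => g p.1 p.2) (x, y) :=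
    (ContDiff.contDiffAt hg).isSymmSndFDerivAt (by
      rw [minSmoothness_of_isRCLikeNormedField]; exact WithTop.coe_le_coe.2 (le_top : (2 : ℕ∞) ≤ ⊤))
  rw [e1, e2, fderiv_clm_apply hd (by fun_prop), fderiv_clm_apply hd (by fun_prop)]
  simpa using hs (1, 0) (0, 1)

lemma S.pd {g : ℝ → ℝ → ℝ} (hg : S g) (a b : ℕ) : S (pd a b g) := by
  have h1 : S (_root_.pdy^[b] g) := by
    induction b with
    | zero => exact hg
    | succ b ih => rw [Function.iterate_succ_apply']; exact ih.pdy
  unfold _root_.pd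
  induction a with
  | zero => exact h1
  | succ a ih => rw [Function.iterate_succ_apply']; exact ih.pdx

lemma pdx_pd (g : ℝ → ℝ → ℝ) (a b : ℕ) : pdx (pd a b g) = pd (a + 1) b g := by
  unfold pd; rw [Function.iterate_succ_apply']

lemma pdy_pd {g : ℝ → ℝ → ℝ} (hg : S g) (a b : ℕ) : pdy (pd a b g) = pd a (b + 1) g := by
  induction a with
  | zero => unfold pd; rw [Function.iterate_succ_apply']; rfl
  | succ a ih => rw [← pdx_pd, ← pd_comm (hg.pd a b), ih, pdx_pd]

lemma S.dx {g : ℝ → ℝ → ℝ} (hg : S g) (x y : ℝ) :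
    DifferentiableAt ℝ (fun t => g t y) x := by
  have := hg.differentiable (by simp)
  exact (this (x, y)).comp (f := fun t : ℝ => (t, y)) x (by fun_prop)

lemma S.dy {g : ℝ → ℝ → ℝ} (hg : S g) (x y : ℝ) :
    DifferentiableAt ℝ (fun t => g x t) y := by
  have := hg.differentiable (by simp)
  exact (this (x, y)).comp (f := fun t : ℝ => (x, t)) y (by fun_prop)

lemma pdx_lin {f g : ℝ → ℝ → ℝ} (hf : S f) (hg : S g) (r s : ℝ) :
    pdx (fun x y => r * f x y - s * g x y) = fun x y => r * pdx f x y - s * pdx g x y := by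
  funext x y
  exact (((hf.dx x y).hasDerivAt.const_mul r).sub ((hg.dx x y).hasDerivAt.const_mul s)).deriv

lemma pdy_lin {f g : ℝ → ℝ → ℝ} (hf : S f) (hg : S g) (r s : ℝ) :
    pdy (fun x y => r * f x y - s * g x y) = fun x y => r * pdy f x y - s * pdy g x y := by
  funext x y
  exact (((hf.dy x y).hasDerivAt.const_mul r).sub ((hg.dy x y).hasDerivAt.const_mul s)).deriv

lemma pdx_zero : pdx (fun _ _ => 0) = fun _ _ => 0 := by
  funext x y; simp [pdx]

lemma pdy_zero : pdy (fun _ _ => 0) = fun _ _ => 0 := by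
  funext x y; simp [pdy]

/-- functions pulled back from the plane -/
def base (g : ℝ → ℝ → ℝ) : Fn := fun x j => g x (j 0)
/-- coordinate functions -/
def vr (c : ℕ) : Fn := fun _ j => j c

inductive Nice : Fn → Prop
  | base (g : ℝ → ℝ → ℝ) (hg : S g) : Nice (base g)
  | vr (c : ℕ) : Nice (vr c)
  | add {F G : Fn} : Nice F → Nice G → Nice (F + G)
  | mul {F G : Fn} : Nice F → Nice G → Nice (F * G)

noncomputable def dx (F : Fn) : Fn := fun x j => deriv (fun t => F t j) x

lemma S_const (c : ℝ) : S (fun _ _ => c) := contDiff_const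

lemma Nice.const (c : ℝ) : Nice (fun _ _ => c) := Nice.base _ (S_const c)
lemma Nice.zero : Nice 0 := Nice.const 0
lemma Nice.one : Nice 1 := Nice.const 1
lemma Nice.neg {F : Fn} (h : Nice F) : Nice (-F) := by
  have : -F = (fun _ _ => (-1 : ℝ)) * F := by funext x j; simp
  rw [this]; exact (Nice.const _).mul h
lemma Nice.sub {F G : Fn} (h : Nice F) (h' : Nice G) : Nice (F - G) := by
  rw [sub_eq_add_neg]; exact h.add h'.neg

lemma Nice.difx {F : Fn} (h : Nice F) (x : ℝ) (j : ℕ → ℝ) :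
    DifferentiableAt ℝ (fun t => F t j) x := by
  induction h with
  | base g hg => exact hg.dx _ _
  | vr c => exact differentiableAt_const _
  | add _ _ ih ih' => exact ih.add ih'
  | mul _ _ ih ih' => exact ih.mul ih'

lemma Nice.difj {F : Fn} (h : Nice F) (x : ℝ) (j : ℕ → ℝ) (a : ℕ) (s : ℝ) :
    DifferentiableAt ℝ (fun t => F x (Function.update j a t)) s := by
  induction h with
  | base g hg =>
    by_cases ha : a = 0
    · subst ha; simpa [Prol.base] using hg.dy x s
    · simp [Prol.base, Function.update_of_ne (Ne.symm ha)]
  | vr c =>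
    by_cases ha : a = c
    · subst ha; simp [Prol.vr]
    · simp [Prol.vr, Function.update_of_ne (Ne.symm ha)]
  | add _ _ ih ih' => exact ih.add ih'
  | mul _ _ ih ih' => exact ih.mul ih'

lemma dx_base (g : ℝ → ℝ → ℝ) : dx (base g) = base (pdx g) := rfl
lemma dx_vr (c : ℕ) : dx (vr c) = 0 := by funext x j; simp [dx, vr]
lemma dx_add {F G : Fn} (h : Nice F) (h' : Nice G) : dx (F + G) = dx F + dx G := by
  funext x j; exact ((h.difx x j).hasDerivAt.add (h'.difx x j).hasDerivAt).deriv
lemma dx_mul {F G : Fn} (h : Nice F) (h' : Nice G) : dx (F * G) = dx F * G + F * dx G := by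
  funext x j; exact ((h.difx x j).hasDerivAt.mul (h'.difx x j).hasDerivAt).deriv

lemma jd_base_zero (g : ℝ → ℝ → ℝ) : jd 0 (base g) = base (pdy g) := by
  funext x j; simp [jd, base, pdy]
lemma jd_base_succ (a : ℕ) (g : ℝ → ℝ → ℝ) : jd (a + 1) (base g) = 0 := by
  funext x j; simp [jd, base]
lemma jd_vr_self (a : ℕ) : jd a (vr a) = 1 := by
  funext x j; simp [jd, vr]
lemma jd_vr_ne {a c : ℕ} (h : a ≠ c) : jd a (vr c) = 0 := by
  funext x j; simp [jd, vr, Function.update_of_ne h.symm]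
lemma jd_vr (a c : ℕ) : jd a (vr c) = if a = c then 1 else 0 := by
  split_ifs with h
  · subst h; exact jd_vr_self a
  · exact jd_vr_ne h
lemma jd_add {F G : Fn} (h : Nice F) (h' : Nice G) (a : ℕ) :
    jd a (F + G) = jd a F + jd a G := by
  funext x j; exact ((h.difj x j a _).hasDerivAt.add (h'.difj x j a _).hasDerivAt).deriv
lemma jd_sub {F G : Fn} (h : Nice F) (h' : Nice G) (a : ℕ) :
    jd a (F - G) = jd a F - jd a G := by
  funext x j; exact ((h.difj x j a _).hasDerivAt.sub (h'.difj x j a _).hasDerivAt).deriv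
lemma jd_mul {F G : Fn} (h : Nice F) (h' : Nice G) (a : ℕ) :
    jd a (F * G) = jd a F * G + F * jd a G := by
  funext x j
  have := ((h.difj x j a (j a)).hasDerivAt.mul (h'.difj x j a (j a)).hasDerivAt).deriv
  simp only [Function.update_eq_self] at this
  exact this
lemma jd_zero (a : ℕ) : jd a (0 : Fn) = 0 := by
  funext x j; simp [jd]
lemma jd_one (a : ℕ) : jd a (1 : Fn) = 0 := by
  funext x j; simp [jd]
lemma dx_zero : dx (0 : Fn) = 0 := by
  funext x j; simp [dx]
lemma dx_one : dx (1 : Fn) = 0 := by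
  funext x j; simp [dx]

lemma Nice.dx {F : Fn} (h : Nice F) : Nice (dx F) := by
  induction h with
  | base g hg => exact Nice.base _ hg.pdx
  | vr c => rw [dx_vr]; exact Nice.zero
  | add h h' ih ih' => rw [dx_add h h']; exact ih.add ih'
  | mul h h' ih ih' => rw [dx_mul h h']; exact (ih.mul h').add (h.mul ih')

lemma Nice.jd {F : Fn} (h : Nice F) (a : ℕ) : Nice (jd a F) := by
  induction h with
  | base g hg =>
    cases a with
    | zero => rw [jd_base_zero]; exact Nice.base _ hg.pdy
    | succ a => rw [jd_base_succ]; exact Nice.zero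
  | vr c => rw [jd_vr]; split_ifs; exacts [Nice.one, Nice.zero]
  | add h h' ih ih' => rw [jd_add h h']; exact ih.add ih'
  | mul h h' ih ih' => rw [jd_mul h h']; exact (ih.mul h').add (h.mul ih')

lemma jd_dx {F : Fn} (h : Nice F) (a : ℕ) : jd a (dx F) = dx (jd a F) := by
  induction h with
  | base g hg =>
    cases a with
    | zero => rw [jd_base_zero, dx_base, dx_base, jd_base_zero, pd_comm hg]
    | succ a => rw [jd_base_succ, dx_base, jd_base_succ, dx_zero]
  | vr c =>
    rw [jd_vr, dx_vr, jd_zero]; split_ifs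
    · rw [dx_one]
    · rw [dx_zero]
  | add h h' ih ih' => rw [dx_add h h', jd_add h h', jd_add h.dx h'.dx, dx_add (h.jd a) (h'.jd a), ih, ih']
  | mul h h' ih ih' =>
    rw [dx_mul h h', jd_mul h h', jd_add (h.dx.mul h') (h.mul h'.dx), jd_mul h.dx h',
      jd_mul h h'.dx, dx_add ((h.jd a).mul h') (h.mul (h'.jd a)), dx_mul (h.jd a) h',
      dx_mul h (h'.jd a), ih, ih']
    ring

lemma jd_jd {F : Fn} (h : Nice F) (a b : ℕ) : jd a (jd b F) = jd b (jd a F) := by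
  induction h with
  | base g hg =>
    rcases a with _ | a <;> rcases b with _ | b <;>
      simp [jd_base_zero, jd_base_succ, jd_zero]
  | vr c =>
    rw [jd_vr, jd_vr]; split_ifs <;> simp [jd_zero, jd_one]
  | add h h' ih ih' =>
    rw [jd_add h h', jd_add h h', jd_add (h.jd b) (h'.jd b), jd_add (h.jd a) (h'.jd a), ih, ih']
  | mul h h' ih ih' =>
    rw [jd_mul h h', jd_mul h h', jd_add ((h.jd b).mul h') (h.mul (h'.jd b)),
      jd_add ((h.jd a).mul h') (h.mul (h'.jd a)), jd_mul (h.jd b) h', jd_mul h (h'.jd b),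
      jd_mul (h.jd a) h', jd_mul h (h'.jd a), ih, ih']
    ring

lemma totalD_zero' (F : Fn) : totalD 0 F = dx F := by
  funext x j; simp [totalD, dx]

lemma totalD_succ (n : ℕ) (F : Fn) : totalD (n + 1) F = totalD n F + vr (n + 1) * jd n F := by
  funext x j; simp [totalD, vr, jd, Finset.sum_range_succ, add_assoc]

lemma Nice.totalD {F : Fn} (h : Nice F) (n : ℕ) : Nice (totalD n F) := by
  induction n with
  | zero => rw [totalD_zero']; exact h.dx
  | succ n ih => rw [totalD_succ]; exact ih.add ((Nice.vr _).mul (h.jd n))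

lemma totalD_of_zero (n : ℕ) : totalD n (0 : Fn) = 0 := by
  funext x j; simp [totalD]

lemma jd_totalD {F : Fn} (h : Nice F) (n a : ℕ) :
    jd (a + 1) (totalD n F) = totalD n (jd (a + 1) F) + if a < n then jd a F else 0 := by
  induction n with
  | zero => simp [totalD_zero', jd_dx h]
  | succ n ih =>
    rw [totalD_succ, totalD_succ, jd_add (h.totalD n) ((Nice.vr _).mul (h.jd n)), ih,
      jd_mul (Nice.vr _) (h.jd n), jd_vr, jd_jd h (a + 1) n]
    rcases lt_trichotomy a n with h1 | h1 | h1
    · rw [if_pos h1, if_neg (by omega), if_pos (by omega)]; ring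
    · subst h1; simp; ring
    · rw [if_neg (by omega), if_neg (by omega), if_neg (by omega)]; ring

/-- the correction term -/
noncomputable def cor (X : ℝ → ℝ → ℝ) (l : ℕ) : Fn :=
  (base (pdx X) + vr 1 * base (pdy X)) * vr (l + 1)

lemma prolong_zero' (X Y : ℝ → ℝ → ℝ) : prolong X Y 0 = base Y := rfl

lemma prolong_succ' (X Y : ℝ → ℝ → ℝ) (l : ℕ) :
    prolong X Y (l + 1) = totalD (l + 1) (prolong X Y l) - cor X l := by
  have : totalD 1 (base X) = base (pdx X) + vr 1 * base (pdy X) := by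
    rw [totalD_succ, totalD_zero', dx_base, jd_base_zero]
  funext x j
  change totalD (l + 1) (prolong X Y l) x j - totalD 1 (base X) x j * j (l + 1) = _
  rw [this]; rfl

lemma nice_cor {X : ℝ → ℝ → ℝ} (hX : S X) (l : ℕ) : Nice (cor X l) :=
  ((Nice.base _ hX.pdx).add ((Nice.vr _).mul (Nice.base _ hX.pdy))).mul (Nice.vr _)

lemma nice_prolong {X Y : ℝ → ℝ → ℝ} (hX : S X) (hY : S Y) (l : ℕ) : Nice (prolong X Y l) := by
  induction l with
  | zero => exact Nice.base _ hY
  | succ l ih => rw [prolong_succ']; exact (ih.totalD _).sub (nice_cor hX l)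

lemma jd_cor {X : ℝ → ℝ → ℝ} (hX : S X) (l b : ℕ) :
    jd (b + 1) (cor X l) = (if b = 0 then base (pdy X) * vr (l + 1) else 0)
      + if b = l then base (pdx X) + vr 1 * base (pdy X) else 0 := by
  have n1 := Nice.base _ hX.pdx
  have n2 := Nice.base _ hX.pdy
  have n3 := (Nice.vr 1).mul n2
  unfold cor
  rw [jd_mul (n1.add n3) (Nice.vr _), jd_add n1 n3, jd_mul (Nice.vr _) n2, jd_base_succ,
    jd_base_succ, jd_vr, jd_vr]
  simp only [Nat.add_eq_right, add_left_inj]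
  split_ifs <;> ring

/-- restriction to vanishing jets -/
def ev (F : Fn) : ℝ → ℝ → ℝ := fun x y => F x (fun c => if c = 0 then y else 0)

lemma ev_totalD (n : ℕ) (F : Fn) : ev (totalD n F) = pdx (ev F) := by
  funext x y; simp [ev, totalD, pdx]

lemma ev_jd_zero (F : Fn) : ev (jd 0 F) = pdy (ev F) := by
  funext x y
  have : ∀ t, Function.update (fun c : ℕ => if c = 0 then y else (0 : ℝ)) 0 t
      = fun c => if c = 0 then t else 0 := by
    intro t; funext c; by_cases h : c = 0
    · subst h; simp
    · simp [h]
  simp [ev, jd, pdy, this]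

lemma ev_jd_cor {X : ℝ → ℝ → ℝ} (hX : S X) (l b : ℕ) :
    ev (jd (b + 1) (cor X l)) = fun x y => if b = l then pdx X x y else 0 := by
  rw [jd_cor hX]; funext x y
  split_ifs <;> simp [ev, base, vr]

lemma ev_jd_jd_cor {X : ℝ → ℝ → ℝ} (hX : S X) (l a b : ℕ) :
    ev (jd (a + 1) (jd (b + 1) (cor X l))) = fun x y =>
      (if b = 0 ∧ a = l then pdy X x y else 0) + (if b = l ∧ a = 0 then pdy X x y else 0) := by
  have n1 := Nice.base _ hX.pdx
  have n2 := Nice.base _ hX.pdy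
  have n3 := (Nice.vr 1).mul n2
  have e1 : jd (a + 1) (if b = 0 then base (pdy X) * vr (l + 1) else 0)
      = if b = 0 ∧ a = l then base (pdy X) else 0 := by
    by_cases hb : b = 0
    · rw [if_pos hb, jd_mul n2 (Nice.vr _), jd_base_succ, jd_vr]
      by_cases ha : a = l <;> simp [ha, hb]
    · simp [hb, jd_zero]
  have e2 : jd (a + 1) (if b = l then base (pdx X) + vr 1 * base (pdy X) else 0)
      = if b = l ∧ a = 0 then base (pdy X) else 0 := by
    by_cases hb : b = l
    · rw [if_pos hb, jd_add n1 n3, jd_mul (Nice.vr _) n2, jd_base_succ, jd_base_succ, jd_vr]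
      by_cases ha : a = 0 <;> simp [ha, hb]
    · simp [hb, jd_zero]
  rw [jd_cor hX, jd_add, e1, e2]
  · funext x y
    split_ifs <;> simp [ev, base]
  · split_ifs; exacts [n2.mul (Nice.vr _), Nice.zero]
  · split_ifs; exacts [n1.add n3, Nice.zero]

section main
variable {X Y : ℝ → ℝ → ℝ}

lemma jd_vanish (hX : S X) (hY : S Y) (l a : ℕ) (h : l < a) : jd a (prolong X Y l) = 0 := by
  induction l generalizing a with
  | zero =>
    obtain ⟨a, rfl⟩ : ∃ b, a = b + 1 := ⟨a - 1, by omega⟩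
    rw [prolong_zero', jd_base_succ]
  | succ l ih =>
    obtain ⟨a, rfl⟩ : ∃ b, a = b + 1 := ⟨a - 1, by omega⟩
    have hn := nice_prolong hX hY l
    rw [prolong_succ', jd_sub (hn.totalD _) (nice_cor hX l), jd_totalD hn, jd_cor hX,
      ih _ (by omega), totalD_of_zero, if_neg (by omega), if_neg (by omega), if_neg (by omega)]
    simp

lemma jd_succ (hX : S X) (hY : S Y) (l a : ℕ) :
    jd (a + 1) (prolong X Y (l + 1)) = totalD (l + 1) (jd (a + 1) (prolong X Y l))
      + jd a (prolong X Y l) - jd (a + 1) (cor X l) := by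
  have hn := nice_prolong hX hY l
  rw [prolong_succ', jd_sub (hn.totalD _) (nice_cor hX l), jd_totalD hn]
  split_ifs with h
  · rfl
  · rw [jd_vanish hX hY l a (by omega)]

lemma jd_jd_succ (hX : S X) (hY : S Y) (l a b : ℕ) :
    jd (a + 1) (jd (b + 1) (prolong X Y (l + 1)))
      = totalD (l + 1) (jd (a + 1) (jd (b + 1) (prolong X Y l)))
      + jd a (jd (b + 1) (prolong X Y l))
      + jd (a + 1) (jd b (prolong X Y l)) - jd (a + 1) (jd (b + 1) (cor X l)) := by
  have hn := nice_prolong hX hY l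
  rw [jd_succ hX hY, jd_sub (((hn.jd _).totalD _).add (hn.jd _)) ((nice_cor hX l).jd _),
    jd_add ((hn.jd _).totalD _) (hn.jd _), jd_totalD (hn.jd _)]
  split_ifs with h
  · rfl
  · rw [jd_jd hn a, jd_vanish hX hY l a (by omega), jd_zero]

lemma ev_jd_succ (hX : S X) (hY : S Y) (l a : ℕ) (x y : ℝ) :
    ev (jd (a + 1) (prolong X Y (l + 1))) x y = pdx (ev (jd (a + 1) (prolong X Y l))) x y
      + ev (jd a (prolong X Y l)) x y - (if a = l then pdx X x y else 0) := by
  rw [← ev_totalD (l + 1), jd_succ hX hY, ← congrFun (congrFun (ev_jd_cor hX l a) x) y]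
  rfl

lemma ev_jd_jd_succ (hX : S X) (hY : S Y) (l a b : ℕ) (x y : ℝ) :
    ev (jd (a + 1) (jd (b + 1) (prolong X Y (l + 1)))) x y
      = pdx (ev (jd (a + 1) (jd (b + 1) (prolong X Y l)))) x y
      + ev (jd a (jd (b + 1) (prolong X Y l))) x y
      + ev (jd (a + 1) (jd b (prolong X Y l))) x y
      - ((if b = 0 ∧ a = l then pdy X x y else 0) + (if b = l ∧ a = 0 then pdy X x y else 0)) := by
  rw [← ev_totalD (l + 1), jd_jd_succ hX hY, ← congrFun (congrFun (ev_jd_jd_cor hX l a b) x) y]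
  rfl

lemma ev_zero : ev 0 = fun _ _ => 0 := rfl

lemma E_eq (l : ℕ) : ev (prolong X Y l) = pd l 0 Y := by
  induction l with
  | zero => funext x y; simp [prolong, ev, pd]
  | succ l ih =>
    rw [← pdx_pd, ← ih, ← ev_totalD (l + 1), prolong_succ']
    funext x y; simp [ev, cor, vr]

lemma A_eq (hX : S X) (hY : S Y) (l a m : ℕ) (h : l = a + m) :
    ev (jd a (prolong X Y l)) = fun x y =>
      (l.choose m : ℝ) * pd m 1 Y x y - (l.choose (m + 1) : ℝ) * pd (m + 1) 0 X x y := by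
  induction l generalizing a m with
  | zero =>
    obtain ⟨rfl, rfl⟩ : a = 0 ∧ m = 0 := by omega
    rw [ev_jd_zero, E_eq, pdy_pd hY]; funext x y; simp
  | succ l ih =>
    rcases a with _ | a
    · obtain rfl : m = l + 1 := by omega
      rw [ev_jd_zero, E_eq, pdy_pd hY]; funext x y; simp
    · funext x y
      rw [ev_jd_succ hX hY, ih a m (by omega)]
      rcases m with _ | m
      · rw [jd_vanish hX hY l _ (by omega), ev_zero, pdx_zero, if_pos (by omega)]
        have : pd 1 0 X = pdx X := rfl
        simp [this]; ring
      · rw [ih (a + 1) m (by omega), pdx_lin (hY.pd _ _) (hX.pd _ _), pdx_pd, pdx_pd,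
          if_neg (by omega), Nat.choose_succ_succ l m, Nat.choose_succ_succ l (m + 1)]
        push_cast; ring

lemma Z_eq (hX : S X) (hY : S Y) (l a b : ℕ) (h : l + 2 ≤ a + b) :
    ev (jd a (jd b (prolong X Y l))) = fun _ _ => 0 := by
  induction l generalizing a b with
  | zero =>
    by_cases hb : 0 < b
    · rw [jd_vanish hX hY _ _ hb, jd_zero, ev_zero]
    · rw [jd_jd (nice_prolong hX hY _), jd_vanish hX hY _ a (by omega), jd_zero, ev_zero]
  | succ l ih =>
    rcases a with _ | a
    · rw [jd_vanish hX hY _ _ (by omega), jd_zero, ev_zero]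
    rcases b with _ | b
    · rw [jd_jd (nice_prolong hX hY _), jd_vanish hX hY _ (a + 1) (by omega), jd_zero, ev_zero]
    funext x y
    rw [ev_jd_jd_succ hX hY, ih _ _ (by omega), ih _ _ (by omega), ih _ _ (by omega), pdx_zero,
      if_neg (by omega), if_neg (by omega)]
    simp

lemma P_eq (hX : S X) (hY : S Y) (l : ℕ) :
    ev (jd 1 (jd (l + 1) (prolong X Y (l + 1)))) = fun x y => -((l : ℝ) + 2) * pd 0 1 X x y := by
  have e : pd 0 1 X = pdy X := rfl
  induction l with
  | zero =>
    funext x y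
    rw [ev_jd_jd_succ hX hY 0 0 0, Z_eq hX hY 0 _ _ (by omega), pdx_zero,
      jd_jd (nice_prolong hX hY _) (0 + 1) 0, jd_vanish hX hY 0 (0 + 1) (by omega), jd_zero, ev_zero]
    simp [e]; ring
  | succ l ih =>
    funext x y
    rw [ev_jd_jd_succ hX hY (l + 1) 0 (l + 1), Z_eq hX hY (l + 1) _ _ (by omega), pdx_zero, ih,
      jd_vanish hX hY (l + 1) (l + 1 + 1) (by omega), jd_zero, ev_zero]
    simp [e]; ring

lemma R_eq (hX : S X) (hY : S Y) (l : ℕ) :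
    ev (jd 1 (jd l (prolong X Y (l + 1)))) = fun x y =>
      ((l : ℝ) + 1) * pd 0 2 Y x y - ((l : ℝ) + 1) ^ 2 * pd 1 1 X x y := by
  induction l with
  | zero =>
    rw [jd_jd (nice_prolong hX hY _), ev_jd_zero, A_eq hX hY 1 1 0 (by omega),
      pdy_lin (hY.pd _ _) (hX.pd _ _), pdy_pd hY, pdy_pd hX]
    funext x y; simp
  | succ l ih =>
    funext x y
    have hp : (fun x y => -((l : ℝ) + 2) * pd 0 1 X x y)
      = fun x y => -((l : ℝ) + 2) * pd 0 1 X x y - 0 * pd 0 1 X x y := by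
      funext x y; ring
    rw [ev_jd_jd_succ hX hY (l + 1) 0 l, P_eq hX hY, hp, pdx_lin (hX.pd _ _) (hX.pd _ _), pdx_pd,
      ih, ev_jd_zero, A_eq hX hY (l + 1) (l + 1) 0 (by omega),
      pdy_lin (hY.pd _ _) (hX.pd _ _), pdy_pd hY, pdy_pd hX, if_neg (by omega), if_neg (by omega)]
    simp; ring

lemma Q_eq (hX : S X) (hY : S Y) (l : ℕ) :
    ev (jd 2 (jd (l + 1) (prolong X Y (l + 2)))) = fun x y =>
      -((l + 3).choose 2 : ℝ) * pd 0 1 X x y := by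
  induction l with
  | zero =>
    rw [jd_jd (nice_prolong hX hY _), P_eq hX hY 1]
    funext x y; norm_num [Nat.choose]
  | succ l ih =>
    funext x y
    rw [ev_jd_jd_succ hX hY (l + 2) 1 (l + 1), Z_eq hX hY (l + 2) _ _ (by omega), pdx_zero, ih,
      P_eq hX hY (l + 1), if_neg (by omega), if_neg (by omega), Nat.choose_succ_succ (l + 3) 1]
    push_cast [Nat.choose_one_right]; ring

end main
end Prol

/-- The nine coefficients of the monomials `1, y_1, y_2, y_{κ-2}, y_{κ-1}, y_1y_{κ-1},
y_2y_{κ-1}, y_κ, y_1y_κ` in the expansion of `𝐘_κ` (κ ≥ 4) as a polynomial in the jet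
variables.  The coefficient of a multilinear monomial is obtained as the corresponding
mixed partial derivative with respect to the jet variables, evaluated at the point where
all jet variables vanish. -/
theorem prolongation_nine_coefficients
    (X Y : ℝ → ℝ → ℝ)
    (hX : ContDiff ℝ (⊤ : ℕ∞) (fun p : ℝ × ℝ => X p.1 p.2))
    (hY : ContDiff ℝ (⊤ : ℕ∞) (fun p : ℝ × ℝ => Y p.1 p.2))
    (κ : ℕ) (hκ : 4 ≤ κ) (x y : ℝ) :
    let j0 : ℕ → ℝ := fun c => if c = 0 then y else 0
    -- constant term
    prolong X Y κ x j0 = pd κ 0 Y x y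
    -- coefficient of y_1
    ∧ jd 1 (prolong X Y κ) x j0
        = (κ.choose 1 : ℝ) * pd (κ - 1) 1 Y x y - pd κ 0 X x y
    -- coefficient of y_2
    ∧ jd 2 (prolong X Y κ) x j0
        = (κ.choose 2 : ℝ) * pd (κ - 2) 1 Y x y - (κ.choose 1 : ℝ) * pd (κ - 1) 0 X x y
    -- coefficient of y_{κ-2}
    ∧ jd (κ - 2) (prolong X Y κ) x j0
        = (κ.choose 2 : ℝ) * pd 2 1 Y x y - (κ.choose 3 : ℝ) * pd 3 0 X x y
    -- coefficient of y_{κ-1}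
    ∧ jd (κ - 1) (prolong X Y κ) x j0
        = (κ.choose 1 : ℝ) * pd 1 1 Y x y - (κ.choose 2 : ℝ) * pd 2 0 X x y
    -- coefficient of y_1 y_{κ-1}
    ∧ jd 1 (jd (κ - 1) (prolong X Y κ)) x j0
        = (κ.choose 1 : ℝ) * pd 0 2 Y x y - (κ : ℝ) ^ 2 * pd 1 1 X x y
    -- coefficient of y_2 y_{κ-1}
    ∧ jd 2 (jd (κ - 1) (prolong X Y κ)) x j0
        = -((κ + 1).choose 2 : ℝ) * pd 0 1 X x y
    -- coefficient of y_κ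
    ∧ jd κ (prolong X Y κ) x j0
        = pd 0 1 Y x y - (κ.choose 1 : ℝ) * pd 1 0 X x y
    -- coefficient of y_1 y_κ
    ∧ jd 1 (jd κ (prolong X Y κ)) x j0
        = -(((κ + 1).choose 1 : ℝ)) * pd 0 1 X x y := by
  intro j0
  have hX' : Prol.S X := hX
  have hY' : Prol.S Y := hY
  have hA := fun a m h => congrFun (congrFun (Prol.A_eq hX' hY' κ a m h) x) y
  have c1 : κ.choose (κ - 1) = κ.choose 1 := Nat.choose_symm (by omega)
  have c2 : κ.choose (κ - 2) = κ.choose 2 := Nat.choose_symm (by omega)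
  have a1 := hA 1 (κ - 1) (by omega)
  have a2 := hA 2 (κ - 2) (by omega)
  rw [show κ - 1 + 1 = κ by omega, c1, Nat.choose_self, Nat.cast_one, one_mul] at a1
  rw [show κ - 2 + 1 = κ - 1 by omega, c1, c2] at a2
  refine ⟨congrFun (congrFun (Prol.E_eq κ) x) y, a1, a2, hA (κ - 2) 2 (by omega),
    hA (κ - 1) 1 (by omega), ?_, ?_, ?_, ?_⟩
  · obtain ⟨l, rfl⟩ : ∃ l, κ = l + 1 := ⟨κ - 1, by omega⟩
    have := congrFun (congrFun (Prol.R_eq hX' hY' l) x) y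
    refine this.trans ?_
    simp
  · obtain ⟨l, rfl⟩ : ∃ l, κ = l + 2 := ⟨κ - 2, by omega⟩
    exact congrFun (congrFun (Prol.Q_eq hX' hY' l) x) y
  · have := hA κ 0 (by omega)
    rw [Nat.choose_zero_right, Nat.cast_one, one_mul] at this
    exact this
  · obtain ⟨l, rfl⟩ : ∃ l, κ = l + 1 := ⟨κ - 1, by omega⟩
    refine (congrFun (congrFun (Prol.P_eq hX' hY' l) x) y).trans ?_
    rw [Nat.choose_one_right]; push_cast; ring
end

section
/- For all indices i_1, i_2 ∈ {1,…,n}, the second-order prolongation coefficient satisfies: 𝐘_{i_1,i_2} = 𝒴_{x^{i_1}x^{i_2}} + Σ_{k_1=1}^n [ δ^{k_1}_{i_1} 𝒴_{x^{i_2}y} + δ^{k_1}_{i_2} 𝒴_{x^{i_1}y} − 𝒳^{k_1}_{x^{i_1}x^{i_2}} ] y_{k_1} + Σ_{k_1,k_2=1}^n [ δ^{k_1}_{i_1} δ^{k_2}_{i_2} 𝒴_{yy} − δ^{k_1}_{i_1} 𝒳^{k_2}_{x^{i_2}y} − δ^{k_1}_{i_2} 𝒳^{k_2}_{x^{i_1}y}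 ] y_{k_1} y_{k_2} + Σ_{k_1,k_2,k_3=1}^n [ −δ^{k_1}_{i_1} δ^{k_2}_{i_2} 𝒳^{k_3}_{yy} ] y_{k_1} y_{k_2} y_{k_3} + Σ_{k_1,k_2=1}^n [ δ^{k_1}_{i_1} δ^{k_2}_{i_2} 𝒴_y − δ^{k_1}_{i_1} 𝒳^{k_2}_{x^{i_2}} − δ^{k_1}_{i_2} 𝒳^{k_2}_{x^{i_1}} ] y_{k_1,k_2} + Σ_{k_1,k_2,k_3=1}^n [ −δ^{k_1}_{i_1} δ^{k_2}_{i_2} 𝒳^{k_3}_y − δ^{k_3}_{i_1} δ^{k_1}_{i_2} 𝒳^{k_2}_y − δ^{k_2}_{i_1} δ^{k_3}_{i_2} 𝒳^{k_1}_y ] y_{k_1} y_{k_2,k_3}. -/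
/-- Kronecker symbol `δ_a^b` as a real number. -/
def kron {α : Type*} [DecidableEq α] (a b : α) : ℝ := if a = b then 1 else 0

/-- Iterated partial derivative of `F(x,y)`, `x ∈ ℝⁿ`, `y ∈ ℝ`, in the `y`-direction,
`b` times. -/
noncomputable def pdY {n : ℕ} (b : ℕ) (F : (Fin n → ℝ) → ℝ → ℝ) :
    (Fin n → ℝ) → ℝ → ℝ := fun x y => iteratedDeriv b (F x) y

/-- Iterated partial derivative of `F(x,y)` with respect to the `x`-coordinates listed
in `xs`. -/
noncomputable def pdXl {n : ℕ} : List (Fin n) → ((Fin n → ℝ) → ℝ → ℝ) →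
    ((Fin n → ℝ) → ℝ → ℝ)
  | [], F => F
  | a :: l, F => fun x y => deriv (fun t => pdXl l F (Function.update x a t) y) (x a)

/-- Mixed partial derivative `∂^{|xs|+b} F / ∂x^{xs} ∂y^b` for `F : ℝⁿ × ℝ → ℝ`. -/
noncomputable def pdN {n : ℕ} (xs : List (Fin n)) (b : ℕ) (F : (Fin n → ℝ) → ℝ → ℝ) :
    (Fin n → ℝ) → ℝ → ℝ := pdXl xs (pdY b F)

/-- The total differentiation operator `D^λ_{i}` for several independent variables and
one dependent variable.  The state is `(x, j)` where `j : Multiset (Fin n) → ℝ` records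
the jet variables: `j 0` is the dependent variable `y` and `j s` (for `s` of cardinality
`c ≥ 1`) is the (symmetric) jet variable `y_s`.
`D^λ_i F = ∂F/∂x^i + Σ_{card s ≤ λ-1} y_{i∪s} ∂F/∂y_s` (the summand for `s = ∅` being
`y_i ∂F/∂y`). -/
noncomputable def totalDn {n : ℕ} (lam : ℕ) (i : Fin n)
    (F : (Fin n → ℝ) → (Multiset (Fin n) → ℝ) → ℝ) :
    (Fin n → ℝ) → (Multiset (Fin n) → ℝ) → ℝ :=
  fun x j =>
    deriv (fun t => F (Function.update x i t) j) (x i)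
    + ∑ c ∈ Finset.range lam, ∑ s ∈ (Finset.univ : Finset (Fin n)).sym c,
        j (i ::ₘ (s : Multiset (Fin n)))
          * deriv (fun t => F x (Function.update j (s : Multiset (Fin n)) t))
              (j (s : Multiset (Fin n)))

/-- The prolongation coefficients `𝐘_{i_1,…,i_λ}` for several independent variables and
one dependent variable.  The list argument records the indices **in reverse order**:
`prolongN X Y [i_λ, …, i_1] = 𝐘_{i_1,…,i_λ}`, following the inductive definition
`𝐘_{i_1,…,i_λ} = D^λ_{i_λ}(𝐘_{i_1,…,i_{λ-1}}) − Σ_k D¹_{i_λ}(𝒳^k)·y_{i_1,…,i_{λ-1},k}`. -/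
noncomputable def prolongN {n : ℕ} (X : Fin n → (Fin n → ℝ) → ℝ → ℝ)
    (Y : (Fin n → ℝ) → ℝ → ℝ) :
    List (Fin n) → (Fin n → ℝ) → (Multiset (Fin n) → ℝ) → ℝ
  | [] => fun x j => Y x (j 0)
  | i :: is => fun x j =>
      totalDn (is.length + 1) i (prolongN X Y is) x j
        - ∑ k : Fin n,
            totalDn 1 i (fun x' j' => X k x' (j' 0)) x j * j (k ::ₘ (is : Multiset (Fin n)))


namespace ProlongAux

/-- Partial derivative in `x^i`. -/
noncomputable def px {n : ℕ} (i : Fin n) (F : (Fin n → ℝ) → ℝ → ℝ) :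
    (Fin n → ℝ) → ℝ → ℝ := fun x y => deriv (fun t => F (Function.update x i t) y) (x i)

/-- Partial derivative in `y`. -/
noncomputable def py {n : ℕ} (F : (Fin n → ℝ) → ℝ → ℝ) :
    (Fin n → ℝ) → ℝ → ℝ := fun x y => deriv (F x) y

/-- Smoothness of the uncurried function. -/
def Sm {n : ℕ} (F : (Fin n → ℝ) → ℝ → ℝ) : Prop :=
  ContDiff ℝ (⊤ : ℕ∞) (fun p : (Fin n → ℝ) × ℝ => F p.1 p.2)

lemma hasDeriv_x0 {n : ℕ} {F : (Fin n → ℝ) → ℝ → ℝ} (hF : Sm F) (i : Fin n)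
    (x : Fin n → ℝ) (y : ℝ) :
    HasDerivAt (fun t => F (Function.update x i t) y)
      (fderiv ℝ (fun p : (Fin n → ℝ) × ℝ => F p.1 p.2) (x, y) (Pi.single i 1, 0)) (x i) := by
  have h1 : HasDerivAt (fun t => ((Function.update x i t, y) : (Fin n → ℝ) × ℝ))
      (Pi.single i 1, 0) (x i) :=
    (hasDerivAt_update x i (x i)).prodMk (hasDerivAt_const _ _)
  have hd : DifferentiableAt ℝ (fun p : (Fin n → ℝ) × ℝ => F p.1 p.2) (x, y) :=
    (ContDiff.differentiable hF (by simp)) _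
  have h2 : HasFDerivAt (fun p : (Fin n → ℝ) × ℝ => F p.1 p.2)
      (fderiv ℝ (fun p : (Fin n → ℝ) × ℝ => F p.1 p.2) (x, y))
      (Function.update x i (x i), y) := by
    rw [Function.update_eq_self]; exact hd.hasFDerivAt
  exact h2.comp_hasDerivAt (x i) h1

lemma hasDeriv_y0 {n : ℕ} {F : (Fin n → ℝ) → ℝ → ℝ} (hF : Sm F)
    (x : Fin n → ℝ) (y : ℝ) :
    HasDerivAt (F x)
      (fderiv ℝ (fun p : (Fin n → ℝ) × ℝ => F p.1 p.2) (x, y) (0, 1)) y := by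
  have h1 : HasDerivAt (fun t => ((x, t) : (Fin n → ℝ) × ℝ)) (0, 1) y :=
    (hasDerivAt_const _ _).prodMk (hasDerivAt_id _)
  have hd : DifferentiableAt ℝ (fun p : (Fin n → ℝ) × ℝ => F p.1 p.2) (x, y) :=
    (ContDiff.differentiable hF (by simp)) _
  exact hd.hasFDerivAt.comp_hasDerivAt y h1

lemma px_eq {n : ℕ} {F : (Fin n → ℝ) → ℝ → ℝ} (hF : Sm F) (i : Fin n)
    (x : Fin n → ℝ) (y : ℝ) : px i F x y =
      fderiv ℝ (fun p : (Fin n → ℝ) × ℝ => F p.1 p.2) (x, y) (Pi.single i 1, 0) :=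
  (hasDeriv_x0 hF i x y).deriv

lemma py_eq {n : ℕ} {F : (Fin n → ℝ) → ℝ → ℝ} (hF : Sm F)
    (x : Fin n → ℝ) (y : ℝ) : py F x y =
      fderiv ℝ (fun p : (Fin n → ℝ) × ℝ => F p.1 p.2) (x, y) (0, 1) :=
  (hasDeriv_y0 hF x y).deriv

lemma hasDeriv_x {n : ℕ} {F : (Fin n → ℝ) → ℝ → ℝ} (hF : Sm F) (i : Fin n)
    (x : Fin n → ℝ) (y : ℝ) :
    HasDerivAt (fun t => F (Function.update x i t) y) (px i F x y) (x i) := by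
  rw [px_eq hF]; exact hasDeriv_x0 hF i x y

lemma hasDeriv_y {n : ℕ} {F : (Fin n → ℝ) → ℝ → ℝ} (hF : Sm F)
    (x : Fin n → ℝ) (y : ℝ) : HasDerivAt (fun t => F x t) (py F x y) y := by
  rw [py_eq hF]; exact hasDeriv_y0 hF x y

lemma smooth_dir {n : ℕ} {F : (Fin n → ℝ) → ℝ → ℝ} (hF : Sm F) (v : (Fin n → ℝ) × ℝ) :
    ContDiff ℝ (⊤ : ℕ∞)
      (fun p => fderiv ℝ (fun p : (Fin n → ℝ) × ℝ => F p.1 p.2) p v) :=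
  (ContDiff.fderiv_right (m := (⊤ : ℕ∞)) hF (by simp)).clm_apply contDiff_const

lemma Sm.px {n : ℕ} {F : (Fin n → ℝ) → ℝ → ℝ} (hF : Sm F) (i : Fin n) : Sm (px i F) := by
  have := smooth_dir hF (Pi.single i 1, 0)
  unfold Sm
  convert this using 2 with p
  exact px_eq hF i p.1 p.2

lemma Sm.py {n : ℕ} {F : (Fin n → ℝ) → ℝ → ℝ} (hF : Sm F) : Sm (py F) := by
  have := smooth_dir hF (0, 1)
  unfold Sm
  convert this using 2 with p
  exact py_eq hF p.1 p.2

lemma dir_comm {n : ℕ} {F : (Fin n → ℝ) → ℝ → ℝ} (hF : Sm F) (u v p : (Fin n → ℝ) × ℝ) :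
    fderiv ℝ (fun p => fderiv ℝ (fun p : (Fin n → ℝ) × ℝ => F p.1 p.2) p u) p v =
    fderiv ℝ (fun p => fderiv ℝ (fun p : (Fin n → ℝ) × ℝ => F p.1 p.2) p v) p u := by
  have hd : DifferentiableAt ℝ (fderiv ℝ (fun p : (Fin n → ℝ) × ℝ => F p.1 p.2)) p :=
    ((ContDiff.fderiv_right (m := (⊤ : ℕ∞)) hF (by simp)).differentiable (by simp)) p
  have hs : IsSymmSndFDerivAt ℝ (fun p : (Fin n → ℝ) × ℝ => F p.1 p.2) p :=
    (ContDiff.contDiffAt hF).isSymmSndFDerivAt (by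
      rw [minSmoothness_of_isRCLikeNormedField]; exact WithTop.coe_le_coe.mpr le_top)
  have key : ∀ w z : (Fin n → ℝ) × ℝ,
      fderiv ℝ (fun p => fderiv ℝ (fun p : (Fin n → ℝ) × ℝ => F p.1 p.2) p w) p z =
      fderiv ℝ (fderiv ℝ (fun p : (Fin n → ℝ) × ℝ => F p.1 p.2)) p z w := by
    intro w z
    rw [fderiv_clm_apply hd (differentiableAt_const w)]
    simp
  rw [key, key, hs.eq]

lemma px_px {n : ℕ} {F : (Fin n → ℝ) → ℝ → ℝ} (hF : Sm F) (i k : Fin n)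
    (x : Fin n → ℝ) (y : ℝ) : px i (px k F) x y = px k (px i F) x y := by
  rw [px_eq (hF.px k), px_eq (hF.px i)]
  simp only [px_eq hF]
  exact dir_comm hF _ _ _

lemma px_py {n : ℕ} {F : (Fin n → ℝ) → ℝ → ℝ} (hF : Sm F) (i : Fin n)
    (x : Fin n → ℝ) (y : ℝ) : py (px i F) x y = px i (py F) x y := by
  rw [px_eq hF.py, py_eq (hF.px i)]
  simp only [px_eq hF, py_eq hF]
  exact dir_comm hF _ _ _

lemma sum_sym_one {n : ℕ} (f : Multiset (Fin n) → ℝ) :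
    ∑ s ∈ (Finset.univ : Finset (Fin n)).sym 1, f (s : Multiset (Fin n)) =
      ∑ a : Fin n, f {a} := by
  symm
  refine Finset.sum_bij (fun a _ => Sym.oneEquiv a) ?_ ?_ ?_ ?_
  · intro a _; exact Finset.mem_sym_iff.mpr fun b _ => Finset.mem_univ b
  · intro a _ b _ h; exact Sym.oneEquiv.injective h
  · intro s _
    obtain ⟨a, rfl⟩ := Sym.oneEquiv.surjective s
    exact ⟨a, Finset.mem_univ _, rfl⟩
  · intro a _; rfl

lemma sum_sym_zero {n : ℕ} (f : Multiset (Fin n) → ℝ) :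
    ∑ s ∈ (Finset.univ : Finset (Fin n)).sym 0, f (s : Multiset (Fin n)) = f 0 := by
  rw [Finset.sym_zero, Finset.sum_singleton]; rfl

lemma totalD_two {n : ℕ} (i : Fin n) (G : (Fin n → ℝ) → (Multiset (Fin n) → ℝ) → ℝ)
    (x : Fin n → ℝ) (j : Multiset (Fin n) → ℝ) :
    totalDn 2 i G x j = deriv (fun t => G (Function.update x i t) j) (x i)
      + j {i} * deriv (fun t => G x (Function.update j 0 t)) (j 0)
      + ∑ a : Fin n, j {i, a} * deriv (fun t => G x (Function.update j {a} t)) (j {a}) := by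
  unfold totalDn
  rw [Finset.sum_range_succ, Finset.sum_range_one,
    sum_sym_one (fun s => j (i ::ₘ s) * deriv (fun t => G x (Function.update j s t)) (j s)),
    sum_sym_zero (fun s => j (i ::ₘ s) * deriv (fun t => G x (Function.update j s t)) (j s))]
  rw [← add_assoc]
  rfl

lemma totalD_one {n : ℕ} (i : Fin n) (F : (Fin n → ℝ) → ℝ → ℝ)
    (x : Fin n → ℝ) (j : Multiset (Fin n) → ℝ) :
    totalDn 1 i (fun x' j' => F x' (j' 0)) x j = px i F x (j 0) + j {i} * py F x (j 0) := by
  unfold totalDn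
  rw [Finset.sum_range_one,
    sum_sym_zero (fun s => j (i ::ₘ s) *
      deriv (fun t => F x (Function.update j s t 0)) (j s))]
  simp [px, py]

lemma prolong_one {n : ℕ} (X : Fin n → (Fin n → ℝ) → ℝ → ℝ) (Y : (Fin n → ℝ) → ℝ → ℝ)
    (i : Fin n) : prolongN X Y [i] = fun x j =>
      (px i Y x (j 0) + j {i} * py Y x (j 0))
        - ∑ k : Fin n, (px i (X k) x (j 0) + j {i} * py (X k) x (j 0)) * j {k} := by
  funext x j
  have h : prolongN X Y [i] x j = totalDn 1 i (fun x' j' => Y x' (j' 0)) x j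
      - ∑ k : Fin n, totalDn 1 i (fun x' j' => X k x' (j' 0)) x j * j {k} := rfl
  rw [h]
  simp only [totalD_one]

lemma hasDeriv_upd {n : ℕ} (j : Multiset (Fin n) → ℝ) (a k : Fin n) (s : ℝ) :
    HasDerivAt (fun t => Function.update j {a} t {k}) (kron a k) s := by
  unfold kron
  by_cases h : a = k
  · subst h; simpa using hasDerivAt_id' s
  · have h' : ({k} : Multiset (Fin n)) ≠ {a} := by
      intro e; exact h (Multiset.singleton_inj.mp e).symm
    simpa [h, Function.update_of_ne h'] using hasDerivAt_const s (j {k})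

end ProlongAux

open ProlongAux

/-- Explicit formula for the second-order prolongation coefficient `𝐘_{i_1,i_2}`
(several independent variables, one dependent variable). -/
theorem prolongation_second_order_n
    (n : ℕ) (hn : 0 < n)
    (X : Fin n → (Fin n → ℝ) → ℝ → ℝ) (Y : (Fin n → ℝ) → ℝ → ℝ)
    (hX : ∀ k, ContDiff ℝ (⊤ : ℕ∞) (fun p : (Fin n → ℝ) × ℝ => X k p.1 p.2))
    (hY : ContDiff ℝ (⊤ : ℕ∞) (fun p : (Fin n → ℝ) × ℝ => Y p.1 p.2))
    (i₁ i₂ : Fin n) (x : Fin n → ℝ) (j : Multiset (Fin n) → ℝ) :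
    prolongN X Y [i₂, i₁] x j =
      pdN [i₁, i₂] 0 Y x (j 0)
      + ∑ k₁ : Fin n,
          (kron i₁ k₁ * pdN [i₂] 1 Y x (j 0) + kron i₂ k₁ * pdN [i₁] 1 Y x (j 0)
            - pdN [i₁, i₂] 0 (X k₁) x (j 0)) * j {k₁}
      + ∑ k₁ : Fin n, ∑ k₂ : Fin n,
          (kron i₁ k₁ * kron i₂ k₂ * pdN [] 2 Y x (j 0)
            - kron i₁ k₁ * pdN [i₂] 1 (X k₂) x (j 0)
            - kron i₂ k₁ * pdN [i₁] 1 (X k₂) x (j 0)) * (j {k₁} * j {k₂})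
      + ∑ k₁ : Fin n, ∑ k₂ : Fin n, ∑ k₃ : Fin n,
          (-(kron i₁ k₁ * kron i₂ k₂ * pdN [] 2 (X k₃) x (j 0)))
            * (j {k₁} * j {k₂} * j {k₃})
      + ∑ k₁ : Fin n, ∑ k₂ : Fin n,
          (kron i₁ k₁ * kron i₂ k₂ * pdN [] 1 Y x (j 0)
            - kron i₁ k₁ * pdN [i₂] 0 (X k₂) x (j 0)
            - kron i₂ k₁ * pdN [i₁] 0 (X k₂) x (j 0)) * j {k₁, k₂}
      + ∑ k₁ : Fin n, ∑ k₂ : Fin n, ∑ k₃ : Fin n,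
          (-(kron i₁ k₁ * kron i₂ k₂ * pdN [] 1 (X k₃) x (j 0))
            - kron i₁ k₃ * kron i₂ k₁ * pdN [] 1 (X k₂) x (j 0)
            - kron i₁ k₂ * kron i₂ k₃ * pdN [] 1 (X k₁) x (j 0))
            * (j {k₁} * j {k₂, k₃}) := by
  have hX' : ∀ k, Sm (X k) := hX
  have hY' : Sm Y := hY
  have h : prolongN X Y [i₂, i₁] x j = totalDn 2 i₂ (prolongN X Y [i₁]) x j
      - ∑ k : Fin n, totalDn 1 i₂ (fun x' j' => X k x' (j' 0)) x j * j {k, i₁} := rfl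
  rw [h, totalD_two, prolong_one]
  simp only [totalD_one]
  have dx : HasDerivAt (fun t => (px i₁ Y (Function.update x i₂ t) (j 0)
        + j {i₁} * py Y (Function.update x i₂ t) (j 0))
        - ∑ k : Fin n, (px i₁ (X k) (Function.update x i₂ t) (j 0)
          + j {i₁} * py (X k) (Function.update x i₂ t) (j 0)) * j {k})
      ((px i₂ (px i₁ Y) x (j 0) + j {i₁} * px i₂ (py Y) x (j 0))
        - ∑ k : Fin n, (px i₂ (px i₁ (X k)) x (j 0)
          + j {i₁} * px i₂ (py (X k)) x (j 0)) * j {k}) (x i₂) := by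
    refine ((hasDeriv_x (hY'.px i₁) i₂ x _).add
      ((hasDeriv_x hY'.py i₂ x _).const_mul _)).sub (HasDerivAt.fun_sum fun k _ => ?_)
    exact (((hasDeriv_x ((hX' k).px i₁) i₂ x _).add
      ((hasDeriv_x (hX' k).py i₂ x _).const_mul _)).mul_const _)
  have dy : HasDerivAt (fun t => (px i₁ Y x t + j {i₁} * py Y x t)
        - ∑ k : Fin n, (px i₁ (X k) x t + j {i₁} * py (X k) x t) * j {k})
      ((px i₁ (py Y) x (j 0) + j {i₁} * py (py Y) x (j 0))
        - ∑ k : Fin n, (px i₁ (py (X k)) x (j 0)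
          + j {i₁} * py (py (X k)) x (j 0)) * j {k}) (j 0) := by
    simp only [← px_py hY', ← fun k => px_py (hX' k)]
    refine ((hasDeriv_y (hY'.px i₁) x _).add
      ((hasDeriv_y hY'.py x _).const_mul _)).sub (HasDerivAt.fun_sum fun k _ => ?_)
    exact (((hasDeriv_y ((hX' k).px i₁) x _).add
      ((hasDeriv_y (hX' k).py x _).const_mul _)).mul_const _)
  have dj : ∀ a : Fin n, HasDerivAt (fun t =>
        (px i₁ Y x (j 0) + Function.update j {a} t {i₁} * py Y x (j 0))
        - ∑ k : Fin n, (px i₁ (X k) x (j 0)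
          + Function.update j {a} t {i₁} * py (X k) x (j 0)) * Function.update j {a} t {k})
      (kron a i₁ * py Y x (j 0)
        - ∑ k : Fin n, ((kron a i₁ * py (X k) x (j 0)) * j {k}
          + (px i₁ (X k) x (j 0) + j {i₁} * py (X k) x (j 0)) * kron a k)) (j {a}) := by
    intro a
    refine (((hasDeriv_upd j a i₁ _).mul_const _).const_add _).sub
      (HasDerivAt.fun_sum fun k _ => ?_)
    have := (((hasDeriv_upd j a i₁ (j {a})).mul_const (py (X k) x (j 0))).const_add
      (px i₁ (X k) x (j 0))).mul (hasDeriv_upd j a k (j {a}))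
    simp only [Function.update_eq_self] at this
    exact this
  have e0 : ∀ (a : Fin n) (t : ℝ), Function.update j {a} t 0 = j 0 := fun a t =>
    Function.update_of_ne (by simp) _ _
  have e1 : ∀ (a : Fin n) (t : ℝ), Function.update j 0 t {a} = j {a} := fun a t =>
    Function.update_of_ne (by simp) _ _
  simp only [e0, e1, Function.update_self]
  rw [dx.deriv, dy.deriv]
  simp only [fun a => (dj a).deriv]
  have p2 : ∀ F : (Fin n → ℝ) → ℝ → ℝ, Sm F →
      pdN [i₁, i₂] 0 F x (j 0) = px i₂ (px i₁ F) x (j 0) := by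
    intro F hF
    rw [px_px hF]
    simp [pdN, pdXl, pdY, px]
  have p11 : ∀ (i : Fin n) (F : (Fin n → ℝ) → ℝ → ℝ),
      pdN [i] 1 F x (j 0) = px i (py F) x (j 0) := by
    intro i F
    simp [pdN, pdXl, pdY, px, py]
  have p10 : ∀ (i : Fin n) (F : (Fin n → ℝ) → ℝ → ℝ),
      pdN [i] 0 F x (j 0) = px i F x (j 0) := by
    intro i F
    simp [pdN, pdXl, pdY, px]
  have p01 : ∀ F : (Fin n → ℝ) → ℝ → ℝ, pdN [] 1 F x (j 0) = py F x (j 0) := by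
    intro F
    simp [pdN, pdXl, pdY, py]
  have p02 : ∀ F : (Fin n → ℝ) → ℝ → ℝ, pdN [] 2 F x (j 0) = py (py F) x (j 0) := by
    intro F
    simp [pdN, pdXl, pdY, py, iteratedDeriv_succ, iteratedDeriv_zero]
    try rfl
  simp only [p2 Y hY', fun k => p2 (X k) (hX' k), p11, p10, p01, p02]
  clear dx dy dj h p2 p11 p10 p01 p02
  have c1 : ∀ k, j {k, i₁} = j {i₁, k} := fun k => by rw [Multiset.pair_comm]
  have c2 : j {i₂, i₁} = j {i₁, i₂} := by rw [Multiset.pair_comm]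
  have c3 : ∀ k, j {k, i₂} = j {i₂, k} := fun k => by rw [Multiset.pair_comm]
  simp only [kron, sub_mul, add_mul, mul_add, mul_sub, neg_mul, ite_mul, mul_ite, one_mul, zero_mul,
    mul_one, mul_zero, Finset.sum_add_distrib, Finset.sum_sub_distrib, Finset.sum_neg_distrib,
    Finset.sum_ite_eq, Finset.sum_ite_eq', Finset.mem_univ, if_true, Finset.sum_ite_irrel,
    Finset.sum_const_zero, Finset.mul_sum]
  simp only [c1, mul_comm, mul_left_comm]
  ring_nf
end

section
/- For every κ ≥ 1 and all indices i_1,…,i_κ ∈ {1,…,n}, evaluating 𝐘_{i_1,…,i_κ} with all jet variables of order ≥ 2 set to zero (the first-order jets y_k arbitrary) yields exactly: 𝒴_{x^{i_1}⋯x^{i_κ}} + Σ_{q=1}^{κ} Σ_{k_1,…,k_q=1}^{n} [ Σ_{τ ∈ S_κ^q} δ^{k_1}_{i_{τ(1)}} ⋯ δ^{k_q}_{i_{τ(q)}} · 𝒴_{x^{i_{τ(q+1)}} ⋯ x^{i_{τ(κ)}} y^q} − Σ_{τ ∈ S_κ^{q−1}} δ^{k_1}_{i_{τ(1)}} ⋯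 δ^{k_{q−1}}_{i_{τ(q−1)}} · 𝒳^{k_q}_{x^{i_{τ(q)}} ⋯ x^{i_{τ(κ)}} y^{q−1}} ] y_{k_1} ⋯ y_{k_q} + Σ_{k_1,…,k_{κ+1}=1}^{n} [ −δ^{k_1}_{i_1} ⋯ δ^{k_κ}_{i_κ} · 𝒳^{k_{κ+1}}_{y^κ} ] y_{k_1} ⋯ y_{k_{κ+1}}, where for q = 1 the 𝒳 sum is over τ ∈ S_κ^0 := {id} with no Kronecker factors. -/
/-- The set `S_κ^q` of permutations of `{0,…,κ-1}` increasing on the first `q`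
positions and on the remaining positions (empty if `q > κ`). -/
def SS (κ q : ℕ) : Finset (Equiv.Perm (Fin κ)) :=
  if κ < q then ∅
  else Finset.univ.filter (fun τ =>
    (∀ a b : Fin κ, (a : ℕ) < (b : ℕ) → (b : ℕ) < q → τ a < τ b) ∧
    (∀ a b : Fin κ, q ≤ (a : ℕ) → (a : ℕ) < (b : ℕ) → τ a < τ b))

abbrev PE (n : ℕ) := (Fin n → ℝ) × ℝ

/-- smooth functions -/
def PV (n : ℕ) : Submodule ℝ (PE n → ℝ) where
  carrier := {f | ContDiff ℝ (⊤ : ℕ∞) f}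
  add_mem' := by
    intro f g hf hg
    exact ContDiff.add (show ContDiff ℝ (⊤ : ℕ∞) f from hf) (show ContDiff ℝ (⊤ : ℕ∞) g from hg)
  zero_mem' := show ContDiff ℝ (⊤ : ℕ∞) (fun _ => (0 : ℝ)) from contDiff_const
  smul_mem' := by
    intro c f hf
    exact ContDiff.const_smul c (show ContDiff ℝ (⊤ : ℕ∞) f from hf)

theorem PV.diff {n : ℕ} (f : PV n) : Differentiable ℝ f.1 :=
  (show ContDiff ℝ (⊤ : ℕ∞) f.1 from f.2).differentiable (by simp)

theorem PV.fd {n : ℕ} (f : PV n) : ContDiff ℝ (⊤ : ℕ∞) (fderiv ℝ f.1) :=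
  (show ContDiff ℝ (⊤ : ℕ∞) f.1 from f.2).fderiv_right (by simp)

/-- directional derivative -/
noncomputable def dd {n : ℕ} (v : PE n) : Module.End ℝ (PV n) where
  toFun f := ⟨fun p => fderiv ℝ f.1 p v, (PV.fd f).clm_apply contDiff_const⟩
  map_add' f g := by
    ext p
    simp [fderiv_add ((PV.diff f) p) ((PV.diff g) p)]
  map_smul' c f := by
    ext p
    simp [fderiv_const_smul ((PV.diff f) p)]

theorem dd_apply {n : ℕ} (v : PE n) (f : PV n) (p : PE n) :
    (dd v f).1 p = fderiv ℝ f.1 p v := rfl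

theorem dd_comm {n : ℕ} (v w : PE n) : dd v * dd w = dd w * dd v := by
  ext f p
  have key : ∀ a b : PE n, (dd a (dd b f)).1 p = fderiv ℝ (fderiv ℝ f.1) p a b := by
    intro a b
    rw [dd_apply]
    have h : (dd b f).1 = fun p => fderiv ℝ f.1 p b := rfl
    rw [h, fderiv_clm_apply (((PV.fd f).differentiable (by simp)) p) (differentiableAt_const b)]
    simp
  have hs : IsSymmSndFDerivAt ℝ f.1 p :=
    ((show ContDiff ℝ (⊤ : ℕ∞) f.1 from f.2).contDiffAt).isSymmSndFDerivAt (by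
      simp only [minSmoothness_of_isRCLikeNormedField]
      exact WithTop.coe_le_coe.2 le_top)
  change (dd v (dd w f)).1 p = (dd w (dd v f)).1 p
  rw [key, key, hs.eq]

theorem dd_lin {n : ℕ} (v w : PE n) (c : ℝ) : dd (v + c • w) = dd v + c • dd w := by
  ext f p
  change fderiv ℝ f.1 p (v + c • w) = fderiv ℝ f.1 p v + c * fderiv ℝ f.1 p w
  simp

/-- x direction -/
def ex {n : ℕ} (i : Fin n) : PE n := (Pi.single i 1, 0)
/-- y direction -/
def ey {n : ℕ} : PE n := (0, 1)

theorem deriv_x {n : ℕ} (f : PV n) (i : Fin n) (x : Fin n → ℝ) (y : ℝ) :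
    deriv (fun t => f.1 (Function.update x i t, y)) (x i) = (dd (ex i) f).1 (x, y) := by
  have h1 : HasDerivAt (fun t => ((Function.update x i t, y) : PE n)) (ex i) (x i) :=
    (hasDerivAt_update x i (x i)).prodMk (hasDerivAt_const _ _)
  have h2 := ((PV.diff f) (Function.update x i (x i), y)).hasFDerivAt.comp_hasDerivAt (x i) h1
  rw [Function.update_eq_self] at h2
  exact h2.deriv

theorem deriv_y {n : ℕ} (f : PV n) (x : Fin n → ℝ) (y : ℝ) :
    deriv (fun t => f.1 (x, t)) y = (dd ey f).1 (x, y) := by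
  have h1 : HasDerivAt (fun t => ((x, t) : PE n)) ey y :=
    (hasDerivAt_const _ _).prodMk (hasDerivAt_id y)
  have h2 := ((PV.diff f) (x, y)).hasFDerivAt.comp_hasDerivAt y h1
  exact h2.deriv

theorem pdY_eq {n : ℕ} (f : PV n) (b : ℕ) :
    pdY b (fun x y => f.1 (x, y)) = fun x y => ((dd ey ^ b) f).1 (x, y) := by
  funext x y
  induction b generalizing y with
  | zero => simp [pdY]
  | succ b ih =>
    unfold pdY at ih ⊢
    rw [iteratedDeriv_succ, funext ih, deriv_y, pow_succ']
    rfl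

theorem pdXl_eq {n : ℕ} (f : PV n) (l : List (Fin n)) :
    pdXl l (fun x y => f.1 (x, y)) =
      fun x y => ((l.map (fun i => dd (ex i))).prod f).1 (x, y) := by
  induction l with
  | nil => simp [pdXl]
  | cons a l ih =>
    funext x y
    simp only [pdXl, ih]
    rw [deriv_x]
    simp

theorem pdN_eq {n : ℕ} (f : PV n) (l : List (Fin n)) (b : ℕ) (x : Fin n → ℝ) (y : ℝ) :
    pdN l b (fun x y => f.1 (x, y)) x y =
      (((l.map (fun i => dd (ex i))).prod * dd ey ^ b : Module.End ℝ (PV n)) f).1 (x, y) := by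
  unfold pdN
  rw [pdY_eq, pdXl_eq]
  rfl

theorem totalDn_red {n : ℕ} (lam : ℕ) (i : Fin n)
    (F : (Fin n → ℝ) → (Multiset (Fin n) → ℝ) → ℝ) (x : Fin n → ℝ)
    (j : Multiset (Fin n) → ℝ)
    (hj : ∀ s : Multiset (Fin n), 2 ≤ Multiset.card s → Multiset.card s ≤ lam + 1 → j s = 0)
    (f : PV n) (hf : ∀ x y, F x (Function.update j 0 y) = f.1 (x, y)) :
    totalDn (lam + 1) i F x j = (dd (ex i + j {i} • ey) f).1 (x, j 0) := by
  unfold totalDn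
  rw [Finset.sum_range_succ', Finset.sum_eq_zero (s := Finset.range lam)]
  · have h0 : ∀ x, F x j = f.1 (x, j 0) := by
      intro x
      rw [← hf, Function.update_eq_self]
    rw [dd_lin]
    simp only [h0, deriv_x]
    have h1 : ∑ s ∈ (Finset.univ : Finset (Fin n)).sym 0, j (i ::ₘ (s : Multiset (Fin n)))
          * deriv (fun t => F x (Function.update j (s : Multiset (Fin n)) t))
              (j (s : Multiset (Fin n))) = j {i} * (dd ey f).1 (x, j 0) := by
      rw [Finset.sym_zero, Finset.sum_singleton]
      change j {i} * deriv (fun t => F x (Function.update j 0 t)) (j 0) = _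
      simp only [hf, deriv_y]
    rw [h1]
    simp
  · intro c hc
    apply Finset.sum_eq_zero
    intro s hs
    rw [hj, zero_mul]
    · simp
    · have := Finset.mem_range.1 hc
      simp; omega

theorem prolong_red {n : ℕ} (X : Fin n → PV n) (Y : PV n) (κ : ℕ) (l : List (Fin n))
    (hl : l.length ≤ κ) (hl0 : l ≠ []) (x : Fin n → ℝ)
    (j : Multiset (Fin n) → ℝ)
    (hj : ∀ s : Multiset (Fin n), 2 ≤ Multiset.card s → Multiset.card s ≤ κ → j s = 0) :
    prolongN (fun k x y => (X k).1 (x, y)) (fun x y => Y.1 (x, y)) l x j =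
      ((l.map (fun i => dd (ex i + j {i} • ey))).prod (Y - ∑ k, j {k} • X k)).1 (x, j 0) := by
  induction l generalizing x j with
  | nil => exact absurd rfl hl0
  | cons i l ih =>
    simp only [List.length_cons] at hl
    simp only [prolongN]
    have hup : ∀ (y : ℝ) (s : Multiset (Fin n)), 0 < Multiset.card s →
        Function.update j 0 y s = j s := by
      intro y s hs
      rw [Function.update_of_ne]
      rintro rfl
      simp at hs
    have hXr : ∀ k, totalDn 1 i (fun x' j' => (X k).1 (x', j' 0)) x j =
        (dd (ex i + j {i} • ey) (X k)).1 (x, j 0) := by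
      intro k
      apply totalDn_red 0
      · intro s h1 h2; omega
      · intro x y; simp
    by_cases h : l = []
    · subst h
      rw [List.length_nil, totalDn_red 0 i _ x j (by intro s h1 h2; omega) Y
        (by intro x y; simp [prolongN])]
      simp only [hXr]
      simp [mul_comm]
    · have hpos : 0 < l.length := List.length_pos_iff.2 h
      rw [totalDn_red l.length i _ x j (fun s h1 h2 => hj s h1 (by omega))
        ((l.map (fun i => dd (ex i + j {i} • ey))).prod (Y - ∑ k, j {k} • X k))]
      · have h0 : ∀ k : Fin n, j (k ::ₘ (l : Multiset (Fin n))) = 0 := by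
          intro k
          apply hj
          · simp; omega
          · simp; omega
        simp only [h0, mul_zero, Finset.sum_const_zero, sub_zero]
        simp
      · intro x y
        rw [ih (by omega) h]
        · simp [hup]
        · intro s h1 h2
          rw [hup _ _ (by omega)]
          exact hj s h1 h2


open scoped IsMulCommutative in
theorem prod_expand_gen {R : Type*} [Ring R] [Algebra ℝ R] {κ : ℕ} (X : Fin κ → R) (Y : R)
    (c : Fin κ → ℝ) (hXX : ∀ a b, X a * X b = X b * X a) (hXY : ∀ a, X a * Y = Y * X a) :
    ((List.ofFn (fun a => X a + c a • Y)).reverse).prod =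
      ∑ t : Finset (Fin κ), (∏ a ∈ t, c a) •
        ((tᶜ.toList.map X).prod * Y ^ t.card) := by
  let S : Set R := Set.range X ∪ {Y}
  have hc : ∀ x ∈ S, ∀ y ∈ S, x * y = y * x := by
    rintro x (⟨a, rfl⟩ | rfl) y (⟨b, rfl⟩ | rfl)
    · exact hXX a b
    · exact hXY a
    · exact (hXY b).symm
    · rfl
  have := Algebra.isMulCommutative_adjoin ℝ hc
  let X' : Fin κ → Algebra.adjoin ℝ S := fun a => ⟨X a, Algebra.subset_adjoin (Or.inl ⟨a, rfl⟩)⟩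
  let Y' : Algebra.adjoin ℝ S := ⟨Y, Algebra.subset_adjoin (Or.inr rfl)⟩
  have main : ((List.ofFn (fun a => X' a + c a • Y')).reverse).prod =
      ∑ t : Finset (Fin κ), (∏ a ∈ t, c a) •
        ((tᶜ.toList.map X').prod * Y' ^ t.card) := by
    rw [List.prod_reverse, List.prod_ofFn]
    simp only [add_comm (X' _)]
    rw [Finset.prod_add, Finset.powerset_univ]
    apply Finset.sum_congr rfl
    intro t _
    rw [Finset.prod_smul, Finset.prod_const, smul_mul_assoc, Finset.prod_map_toList,
      Finset.compl_eq_univ_sdiff, mul_comm]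
  have := congrArg (Algebra.adjoin ℝ S).val main
  simp only [map_list_prod, map_sum, map_smul, map_mul, map_pow, List.map_map, List.map_reverse,
    List.map_ofFn] at this
  exact this

theorem prod_expand {n κ : ℕ} (i : Fin κ → Fin n) (c : Fin n → ℝ) :
    (((List.ofFn i).reverse).map (fun i => dd (ex i + c i • ey))).prod =
      ∑ t : Finset (Fin κ), (∏ a ∈ t, c (i a)) •
        (((tᶜ.toList).map (fun a => dd (ex (i a)))).prod * dd ey ^ t.card) := by
  rw [← prod_expand_gen (fun a => dd (ex (i a))) (dd ey) (fun a => c (i a))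
    (fun _ _ => dd_comm _ _) (fun _ => dd_comm _ _), List.map_reverse, List.map_ofFn]
  simp only [Function.comp_def, dd_lin]

theorem list_prod_perm {R : Type*} [Monoid R] {ι : Type*} (X : ι → R)
    (h : ∀ a b, X a * X b = X b * X a) {l l' : List ι} (hl : l.Perm l') :
    (l.map X).prod = (l'.map X).prod := by
  apply (hl.map X).prod_eq'
  rw [List.pairwise_map]
  exact List.pairwise_of_forall (fun a b => h a b)

/-- first block -/
def blk {κ : ℕ} (q : ℕ) (τ : Equiv.Perm (Fin κ)) : Finset (Fin κ) :=
  (Finset.univ.filter (fun a : Fin κ => (a : ℕ) < q)).map τ.toEmbedding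

theorem sum_SS (κ q : ℕ) (hq : q ≤ κ) (f : Finset (Fin κ) → ℝ) :
    ∑ τ ∈ SS κ q, f (blk q τ) = ∑ t ∈ Finset.powersetCard q Finset.univ, f t := by
  obtain ⟨r, rfl⟩ := Nat.exists_eq_add_of_le hq
  have hmem : ∀ τ, τ ∈ SS (q + r) q ↔ StrictMono (fun a : Fin q => τ (Fin.castAdd r a)) ∧
      StrictMono (fun a : Fin r => τ (Fin.natAdd q a)) := by
    intro τ
    simp only [SS, if_neg (not_lt.2 hq), Finset.mem_filter, Finset.mem_univ, true_and]
    constructor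
    · rintro ⟨h1, h2⟩
      exact ⟨fun a b hab => h1 _ _ (by simpa using hab) (by simp),
        fun a b hab => h2 _ _ (by simp) (by simpa using hab)⟩
    · rintro ⟨h1, h2⟩
      constructor
      · intro a b hab hb
        exact h1 (a := ⟨a, by omega⟩) (b := ⟨b, hb⟩) hab
      · intro a b ha hab
        have := h2 (a := ⟨a - q, by omega⟩) (b := ⟨b - q, by omega⟩)
          (by simp only [Fin.lt_def]; omega)
        have ea : Fin.natAdd q (⟨a - q, by omega⟩ : Fin r) = a := by ext; simp; omega
        have eb : Fin.natAdd q (⟨b - q, by omega⟩ : Fin r) = b := by ext; simp; omega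
        simpa only [ea, eb] using this
  have hblk : ∀ (τ : Equiv.Perm (Fin (q + r))) (a : Fin (q + r)),
      τ a ∈ blk q τ ↔ (a : ℕ) < q := by
    intro τ a
    simp [blk]
  have hcard : ∀ τ : Equiv.Perm (Fin (q + r)), (blk q τ).card = q := by
    intro τ
    simp [blk, Fin.card_filter_val_lt]
  have hcard' : ∀ τ : Equiv.Perm (Fin (q + r)), (blk q τ)ᶜ.card = r := by
    intro τ
    simp [Finset.card_compl, hcard]
  apply Finset.sum_bij (fun τ _ => blk q τ)
  · intro τ _
    simp [Finset.mem_powersetCard, hcard]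
  · intro τ hτ σ hσ h
    rw [hmem] at hτ hσ
    have e1 := Finset.orderEmbOfFin_unique (hcard τ) (fun a => (hblk τ _).2 (by simp)) hτ.1
    have e2 := Finset.orderEmbOfFin_unique (hcard τ)
      (fun a => by rw [h]; exact (hblk σ _).2 (by simp)) hσ.1
    have e3 := Finset.orderEmbOfFin_unique (hcard' τ)
      (fun a => by rw [Finset.mem_compl, hblk]; simp) hτ.2
    have e4 := Finset.orderEmbOfFin_unique (hcard' τ)
      (fun a => by rw [h, Finset.mem_compl, hblk]; simp) hσ.2
    ext1 a
    refine Fin.addCases (fun a => ?_) (fun a => ?_) a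
    · exact congrFun (e1.trans e2.symm) a
    · exact congrFun (e3.trans e4.symm) a
  · intro t ht
    have h1 : t.card = q := (Finset.mem_powersetCard.1 ht).2
    have h2 : tᶜ.card = r := by simp [Finset.card_compl, h1]
    refine ⟨finSumFinEquiv.symm.trans (finSumEquivOfFinset h1 h2), ?_, ?_⟩
    · rw [hmem]
      constructor
      · intro a b hab
        simpa using hab
      · intro a b hab
        simpa using hab
    · symm
      apply Finset.eq_of_subset_of_card_le
      · intro a ha
        obtain ⟨b, hb⟩ : ∃ b : Fin q, t.orderEmbOfFin h1 b = a := by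
          have : a ∈ Set.range (t.orderEmbOfFin h1) := by simpa using ha
          exact this
        have := (hblk (finSumFinEquiv.symm.trans (finSumEquivOfFinset h1 h2))
          (Fin.castAdd r b)).2 (by simp)
        simpa [hb] using this
      · rw [hcard, h1]
  · intro τ _
    rfl

theorem blk_compl_perm {κ : ℕ} (q : ℕ) (τ : Equiv.Perm (Fin κ)) :
    ((blk q τ)ᶜ.toList).Perm (((List.finRange κ).drop q).map τ) := by
  apply (List.perm_ext_iff_of_nodup (Finset.nodup_toList _) _).2
  · intro b
    obtain ⟨a, rfl⟩ := τ.surjective b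
    simp only [Finset.mem_toList, Finset.mem_compl, blk, List.mem_map, List.mem_drop_iff_getElem]
    simp
    constructor
    · intro h
      exact ⟨a - q, by omega, by ext; simp; omega⟩
    · rintro ⟨m, hm, h⟩
      have := congrArg Fin.val h
      simp at this
      omega
  · exact ((List.nodup_finRange κ).sublist (List.drop_sublist _ _)).map τ.injective

theorem kron_prod {q n : ℕ} (u k : Fin q → Fin n) :
    ∏ a, kron (u a) (k a) = if k = u then 1 else 0 := by
  unfold kron
  rw [Finset.prod_ite_zero]
  simp [funext_iff, eq_comm]

theorem prod_blk {κ q : ℕ} (hq : q ≤ κ) (τ : Equiv.Perm (Fin κ)) (g : Fin κ → ℝ) :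
    ∏ a ∈ blk q τ, g a = ∏ a : Fin q, g (τ ⟨a, a.2.trans_le hq⟩) := by
  rw [blk, Finset.prod_map]
  symm
  apply Finset.prod_bij (fun (a : Fin q) _ => (⟨a, a.2.trans_le hq⟩ : Fin κ))
  · intro a _; simp
  · intro a _ b _ h; ext; simpa using h
  · intro b hb; exact ⟨⟨b, by simpa using hb⟩, by simp, rfl⟩
  · intro a _; rfl

theorem expand_SS {n κ : ℕ} (hκ : 0 < κ) (i : Fin κ → Fin n) (c : Fin n → ℝ) (F : PV n)
    (x : Fin n → ℝ) (y : ℝ) :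
    ((((List.ofFn i).reverse).map (fun i => dd (ex i + c i • ey))).prod F).1 (x, y) =
      ∑ q ∈ Finset.range (κ + 1), ∑ τ ∈ SS κ q,
        (∏ a : Fin q, c (if h : (a : ℕ) < κ then i (τ ⟨a, h⟩) else i ⟨0, hκ⟩)) *
          pdN (((List.finRange κ).drop q).map (fun b => i (τ b))) q
            (fun x y => F.1 (x, y)) x y := by
  rw [prod_expand]
  let G : Finset (Fin κ) → ℝ := fun t => (∏ a ∈ t, c (i a)) *
        ((((tᶜ.toList).map (fun a => dd (ex (i a)))).prod * dd ey ^ t.card : Module.End ℝ (PV n)) F).1 (x, y)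
  have h1 : ((∑ t : Finset (Fin κ), (∏ a ∈ t, c (i a)) •
        (((tᶜ.toList).map (fun a => dd (ex (i a)))).prod * dd ey ^ t.card) : Module.End ℝ (PV n)) F).1 (x, y)
      = ∑ t : Finset (Fin κ), G t := by
    rw [LinearMap.sum_apply, AddSubmonoidClass.coe_finsetSum, Finset.sum_apply]
    rfl
  rw [h1, ← Finset.powerset_univ, Finset.sum_powerset]
  simp only [Finset.card_univ, Fintype.card_fin]
  apply Finset.sum_congr rfl
  intro q hq
  have hq : q ≤ κ := by have := Finset.mem_range.1 hq; omega
  rw [← sum_SS κ q hq]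
  apply Finset.sum_congr rfl
  intro τ _
  simp only [G]
  rw [prod_blk hq τ (fun a => c (i a)), pdN_eq,
    list_prod_perm _ (fun _ _ => dd_comm _ _) (blk_compl_perm q τ), List.map_map, List.map_map]
  have : (blk q τ).card = q := by
    simp [blk, Fin.card_filter_val_lt, hq]
  rw [this]
  congr 1
  apply Finset.prod_congr rfl
  intro a _
  rw [dif_pos (a.2.trans_le hq)]

theorem collapse {q n : ℕ} (u : Fin q → Fin n) (c : Fin n → ℝ) :
    ∑ k : Fin q → Fin n, (∏ a, kron (u a) (k a)) * ∏ a, c (k a) = ∏ a, c (u a) := by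
  simp [kron_prod]

theorem collapse_last {q n : ℕ} (u : Fin q → Fin n) (c : Fin n → ℝ) (g : Fin n → ℝ) :
    ∑ k : Fin (q + 1) → Fin n, (∏ a : Fin q, kron (u a) (k a.castSucc)) * g (k (Fin.last q)) *
      ∏ a, c (k a) = ∑ m, c m * ((∏ a, c (u a)) * g m) := by
  rw [← (Fin.snocEquiv (fun _ : Fin (q + 1) => Fin n)).sum_comp, Fintype.sum_prod_type]
  apply Finset.sum_congr rfl
  intro m _
  simp only [Fin.snocEquiv, Equiv.coe_fn_mk, Fin.prod_univ_castSucc, Fin.snoc_castSucc,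
    Fin.snoc_last]
  rw [← collapse u c, Finset.sum_mul, Finset.mul_sum]
  apply Finset.sum_congr rfl
  intro k _
  ring

theorem SS_zero (κ : ℕ) : SS κ 0 = {1} := by
  ext τ
  simp only [SS, Nat.not_lt_zero, if_false, Finset.mem_filter, Finset.mem_univ, true_and,
    Finset.mem_singleton, Nat.zero_le, true_implies, false_implies, implies_true]
  constructor
  · intro h
    have hm : StrictMono τ := fun a b hab => h a b hab
    have := Subsingleton.elim (hm.orderIsoOfSurjective τ τ.surjective) (OrderIso.refl _)
    ext1 a
    exact congrArg (fun e : Fin κ ≃o Fin κ => e a) this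
  · rintro rfl a b hab
    exact hab

theorem SS_self (κ : ℕ) : SS κ κ = {1} := by
  ext τ
  simp only [SS, lt_irrefl, if_false, Finset.mem_filter, Finset.mem_univ, true_and,
    Finset.mem_singleton]
  constructor
  · intro h
    have hm : StrictMono τ := fun a b hab => h.1 a b hab b.2
    have := Subsingleton.elim (hm.orderIsoOfSurjective τ τ.surjective) (OrderIso.refl _)
    ext1 a
    exact congrArg (fun e : Fin κ ≃o Fin κ => e a) this
  · rintro rfl
    exact ⟨fun a b hab _ => hab, fun a b _ hab => hab⟩

/-- Evaluating `𝐘_{i_1,…,i_κ}` with all jet variables of order ≥ 2 set to zero yields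
exactly the part of the closed formula involving only first-order jets. -/
theorem prolongation_pure_first_jet_part_n
    (n : ℕ) (hn : 0 < n)
    (X : Fin n → (Fin n → ℝ) → ℝ → ℝ) (Y : (Fin n → ℝ) → ℝ → ℝ)
    (hX : ∀ k, ContDiff ℝ (⊤ : ℕ∞) (fun p : (Fin n → ℝ) × ℝ => X k p.1 p.2))
    (hY : ContDiff ℝ (⊤ : ℕ∞) (fun p : (Fin n → ℝ) × ℝ => Y p.1 p.2))
    (κ : ℕ) (hκ : 0 < κ) (i : Fin κ → Fin n)
    (x : Fin n → ℝ) (j : Multiset (Fin n) → ℝ)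
    (hj : ∀ s : Multiset (Fin n), 2 ≤ Multiset.card s → Multiset.card s ≤ κ → j s = 0) :
    prolongN X Y ((List.ofFn i).reverse) x j =
      pdN (List.ofFn i) 0 Y x (j 0)
      + ∑ qm1 ∈ Finset.range κ,
          ∑ k : Fin (qm1 + 1) → Fin n,
            ((∑ τ ∈ SS κ (qm1 + 1),
                (∏ a : Fin (qm1 + 1),
                    kron (if h : (a : ℕ) < κ then i (τ ⟨a, h⟩) else i ⟨0, hκ⟩) (k a))
                  * pdN (((List.finRange κ).drop (qm1 + 1)).map (fun b => i (τ b)))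
                      (qm1 + 1) Y x (j 0))
              - ∑ τ ∈ SS κ qm1,
                (∏ a : Fin qm1,
                    kron (if h : (a : ℕ) < κ then i (τ ⟨a, h⟩) else i ⟨0, hκ⟩)
                      (k a.castSucc))
                  * pdN (((List.finRange κ).drop qm1).map (fun b => i (τ b)))
                      qm1 (X (k (Fin.last qm1))) x (j 0))
            * ∏ a : Fin (qm1 + 1), j {k a}
      + ∑ k : Fin (κ + 1) → Fin n,
          (-((∏ a : Fin κ, kron (i a) (k a.castSucc))
              * pdN [] κ (X (k (Fin.last κ))) x (j 0)))
            * ∏ a : Fin (κ + 1), j {k a} := by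
  obtain ⟨X', hX'⟩ : ∃ X' : Fin n → PV n, X = fun k x y => (X' k).1 (x, y) :=
    ⟨fun k => ⟨_, hX k⟩, rfl⟩
  obtain ⟨Y', hY'⟩ : ∃ Y' : PV n, Y = fun x y => Y'.1 (x, y) := ⟨⟨_, hY⟩, rfl⟩
  subst hX' hY'
  rw [prolong_red X' Y' κ _ (by simp) (by simp; omega) x j hj]
  let T : ℕ → PV n → ℝ := fun q F => ∑ τ ∈ SS κ q,
        (∏ a : Fin q, j {if h : (a : ℕ) < κ then i (τ ⟨a, h⟩) else i ⟨0, hκ⟩}) *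
          pdN (((List.finRange κ).drop q).map (fun b => i (τ b))) q
            (fun x y => F.1 (x, y)) x (j 0)
  have hT : ∀ F : PV n, ((((List.ofFn i).reverse).map
      (fun i => dd (ex i + j {i} • ey))).prod F).1 (x, j 0) =
      ∑ q ∈ Finset.range (κ + 1), T q F :=
    fun F => expand_SS hκ i (fun k => j {k}) F x (j 0)
  have hL : ((((List.ofFn i).reverse).map
      (fun i => dd (ex i + j {i} • ey))).prod (Y' - ∑ k, j {k} • X' k)).1 (x, j 0) =
      ∑ q ∈ Finset.range (κ + 1), T q Y' -
        ∑ k, j {k} * ∑ q ∈ Finset.range (κ + 1), T q (X' k) := by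
    simp only [← hT]
    rw [map_sub, map_sum]
    simp only [map_smul]
    simp
  rw [hL]
  have hT0 : T 0 Y' = pdN (List.ofFn i) 0 (fun x y => Y'.1 (x, y)) x (j 0) := by
    simp only [T, SS_zero, Finset.sum_singleton]
    simp [List.ofFn_eq_map]
  have hYq : ∀ q, ∑ k : Fin q → Fin n, (∑ τ ∈ SS κ q,
                (∏ a : Fin q,
                    kron (if h : (a : ℕ) < κ then i (τ ⟨a, h⟩) else i ⟨0, hκ⟩) (k a))
                  * pdN (((List.finRange κ).drop q).map (fun b => i (τ b)))
                      q (fun x y => Y'.1 (x, y)) x (j 0)) * ∏ a : Fin q, j {k a} = T q Y' := by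
    intro q
    simp only [T, Finset.sum_mul]
    rw [Finset.sum_comm]
    apply Finset.sum_congr rfl
    intro τ _
    rw [← collapse _ (fun m => j {m}), Finset.sum_mul]
    apply Finset.sum_congr rfl
    intro k _
    ring
  have hXq : ∀ q, ∑ k : Fin (q + 1) → Fin n, (∑ τ ∈ SS κ q,
                (∏ a : Fin q,
                    kron (if h : (a : ℕ) < κ then i (τ ⟨a, h⟩) else i ⟨0, hκ⟩)
                      (k a.castSucc))
                  * pdN (((List.finRange κ).drop q).map (fun b => i (τ b)))
                      q (fun x y => (X' (k (Fin.last q))).1 (x, y)) x (j 0))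
              * ∏ a : Fin (q + 1), j {k a} = ∑ k, j {k} * T q (X' k) := by
    intro q
    simp only [T, Finset.sum_mul, Finset.mul_sum]
    rw [Finset.sum_comm, Finset.sum_comm (s := Finset.univ) (t := SS κ q)]
    apply Finset.sum_congr rfl
    intro τ _
    exact collapse_last _ (fun m => j {m}) (fun m =>
      pdN (((List.finRange κ).drop q).map (fun b => i (τ b)))
                      q (fun x y => (X' m).1 (x, y)) x (j 0))
  have hlast : ∑ k : Fin (κ + 1) → Fin n,
          (-((∏ a : Fin κ, kron (i a) (k a.castSucc))
              * pdN [] κ (fun x y => (X' (k (Fin.last κ))).1 (x, y)) x (j 0)))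
            * ∏ a : Fin (κ + 1), j {k a} = - ∑ k, j {k} * T κ (X' k) := by
    rw [← hXq κ, ← Finset.sum_neg_distrib]
    apply Finset.sum_congr rfl
    intro k _
    rw [SS_self, Finset.sum_singleton]
    have hd : (List.finRange κ).drop κ = [] := by simp
    simp [hd]
  rw [hlast]
  simp only [sub_mul, Finset.sum_sub_distrib, hYq, hXq]
  rw [Finset.sum_range_succ' (fun q => T q Y'), hT0]
  simp only [Finset.sum_range_succ (fun q => T q (X' _)), mul_add, Finset.sum_add_distrib]
  simp only [Finset.mul_sum]
  rw [Finset.sum_comm (s := Finset.univ) (t := Finset.range κ)]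
  ring
end
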